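/- arXiv:2506.09328 — 2 statements merged into one kernel-verified Lean document; each statement's English description precedes it below -/
import Mathlib

section
/- With the notation of the Clarke subdifferential formula for eigenvalues of compact positive self-adjoint operators, the approximate (A-)subdifferential of λ_k at T is the subset of the Clarke subdifferential consisting of operators of small rank: ∂_A λ_k(T) = { t ∈ ∂_C λ_k(T) : rank t ≤ k_max − k + 1 }, where k_max = max{ k' : λ_{k'}(T) = λ_k(T) }. -/
/- The approximate (A-)subdifferential of `λ_k` at a positive compact self-adjoint
operator `T` with `λ_k(T) > 0` is the subset of the Clarke subdifferential consisting
of the elements of rank at most `k_max − k + 1`, where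
`k_max = max{k' : λ_{k'}(T) = λ_k(T)}`.  Such elements are exactly the functionals
`S ↦ Σ_{i<k_max−k+1} ⟪S φᵢ, φᵢ⟫` with `φᵢ ∈ E_k(T)`. -/

open Filter Topology
open scoped RealInnerProductSpace

variable {E : Type*} [NormedAddCommGroup E] [NormedSpace ℝ E]

/-- The Clarke directional derivative. -/
noncomputable def clarkeDeriv (f : E → ℝ) (x v : E) : ℝ :=
  Filter.limsup (fun p : E × ℝ => (f (p.1 + p.2 • v) - f p.1) / p.2)
    ((𝓝 x) ×ˢ (𝓝[>] (0 : ℝ)))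

/-- The Clarke subdifferential. -/
def clarkeSubdiff (f : E → ℝ) (x : E) : Set (E →L[ℝ] ℝ) :=
  {ξ | ∀ v : E, ξ v ≤ clarkeDeriv f x v}

variable (H : Type*) [NormedAddCommGroup H] [InnerProductSpace ℝ H] [CompleteSpace H]

/-- The space `K_sa[H]` of compact self-adjoint operators, as a (normed) subspace of
the bounded operators. -/
noncomputable def Ksa : Submodule ℝ (H →L[ℝ] H) where
  carrier := {S | IsSelfAdjoint S ∧ IsCompactOperator S}
  add_mem' := fun ha hb => ⟨ha.1.add hb.1, ha.2.add hb.2⟩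
  zero_mem' := ⟨.zero _, isCompactOperator_zero⟩
  smul_mem' := fun c x hx => ⟨by
    rw [isSelfAdjoint_iff, star_smul, star_trivial, hx.1.star_eq], hx.2.smul c⟩

variable {H}

/-- Courant–Fischer value: the `k`-th eigenvalue from the top (for positive compact
self-adjoint operators), `λ_k(T) = sup_{dim V = k} inf_{φ ∈ V, ‖φ‖=1} ⟪Tφ,φ⟫`. -/
noncomputable def lamK (T : H →L[ℝ] H) (k : ℕ) : ℝ :=
  sSup {r : ℝ | ∃ V : Submodule ℝ H, Module.finrank ℝ V = k ∧
    ∀ φ ∈ V, ‖φ‖ = 1 → r ≤ ⟪T φ, φ⟫}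


/-- Dini–Hadamard subdifferential of `f` restricted to the affine set `x + L`, at `x`:
`{ξ : ⟨ξ,v⟩ ≤ liminf_{ṽ→v in L, τ↓0} (f(x+τṽ) − f(x))/τ }` (with values in `EReal`). -/
noncomputable def diniSubdiffOn (f : E → ℝ) (L : Submodule ℝ E) (x : E) :
    Set (E →L[ℝ] ℝ) :=
  {ξ | ∀ v : E, ((ξ v : ℝ) : EReal) ≤
    Filter.liminf (fun p : E × ℝ => (((f (x + p.2 • p.1) - f x) / p.2 : ℝ) : EReal))
      ((𝓝[(L : Set E)] v) ×ˢ (𝓝[>] (0 : ℝ)))}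

/-- The approximate (A-)subdifferential:
`∂_A f(x) = ⋂_{L fin-dim} limsup_{x̃ →_f x} ∂⁻ f_{x̃+L}(x̃)`, where the upper limit is
the set of weak-* cluster points. -/
def approxSubdiff (f : E → ℝ) (x : E) : Set (E →L[ℝ] ℝ) :=
  {ξ | ∀ L : Submodule ℝ E, FiniteDimensional ℝ L →
    ∀ (s : Finset E) (ε : ℝ), 0 < ε → ∀ (δ : ℝ), 0 < δ → ∀ U ∈ 𝓝 x,
      ∃ x' ∈ U, |f x' - f x| < δ ∧
        ∃ η ∈ diniSubdiffOn f L x', ∀ v ∈ s, |η v - ξ v| < ε}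

set_option linter.unusedSectionVars false

theorem exists_finrank_eq_between {V W : Submodule ℝ H} [FiniteDimensional ℝ W] (h : V ≤ W)
    {n : ℕ} (h1 : Module.finrank ℝ V ≤ n) (h2 : n ≤ Module.finrank ℝ W) :
    ∃ X : Submodule ℝ H, V ≤ X ∧ X ≤ W ∧ Module.finrank ℝ X = n := by
  induction n, h1 using Nat.le_induction with
  | base => exact ⟨V, le_rfl, h, rfl⟩
  | succ n hn ih =>
    obtain ⟨X, hVX, hXW, hX⟩ := ih (by omega)
    have hlt : X < W := lt_of_le_of_ne hXW (by rintro rfl; omega)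
    obtain ⟨x, hxW, hxX⟩ := SetLike.exists_of_lt hlt
    have : FiniteDimensional ℝ X := Submodule.finiteDimensional_of_le hXW
    have hle : X ⊔ ℝ ∙ x ≤ W :=
      sup_le hXW ((Submodule.span_singleton_le_iff_mem _ _).2 hxW)
    refine ⟨X ⊔ ℝ ∙ x, hVX.trans le_sup_left, hle, ?_⟩
    have hlt' : X < X ⊔ ℝ ∙ x := lt_of_le_of_ne le_sup_left fun he =>
      hxX (he ▸ (le_sup_right : ℝ ∙ x ≤ X ⊔ ℝ ∙ x) (Submodule.mem_span_singleton_self x))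
    have h3 := Submodule.finrank_lt_finrank_of_lt hlt'
    have h4 := Submodule.finrank_add_le_finrank_add_finrank X (ℝ ∙ x)
    have h5 : Module.finrank ℝ (ℝ ∙ x) = 1 :=
      finrank_span_singleton fun h0 => hxX (h0 ▸ X.zero_mem)
    omega

/-- A subspace whose dimension exceeds that of `X` meets `Xᗮ` nontrivially. -/
theorem exists_unit_mem_orthogonal {X V : Submodule ℝ H} [FiniteDimensional ℝ X]
    (h : Module.finrank ℝ X < Module.finrank ℝ V) : ∃ φ ∈ V, φ ∈ Xᗮ ∧ ‖φ‖ = 1 := by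
  have : FiniteDimensional ℝ V := Module.finite_of_finrank_pos (by omega)
  let f : V →ₗ[ℝ] X := (X.orthogonalProjectionOnto : H →ₗ[ℝ] X) ∘ₗ V.subtype
  obtain ⟨x, hx, hx0⟩ := (Submodule.ne_bot_iff _).1 (LinearMap.ker_ne_bot_of_finrank_lt (f := f) h)
  have hx' : (x : H) ∈ Xᗮ := by
    rw [← Submodule.ker_orthogonalProjectionOnto]; exact hx
  have hx1 : (x : H) ≠ 0 := by simpa using hx0
  exact ⟨(‖(x : H)‖⁻¹ : ℝ) • (x : H), V.smul_mem _ x.2, Submodule.smul_mem _ _ hx',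
    norm_smul_inv_norm hx1⟩

theorem lamK_le {T : H →L[ℝ] H} {k : ℕ} {b : ℝ} (hb : 0 ≤ b)
    (h : ∀ V : Submodule ℝ H, Module.finrank ℝ V = k → ∃ φ ∈ V, ‖φ‖ = 1 ∧ ⟪T φ, φ⟫ ≤ b) :
    lamK T k ≤ b := by
  refine Real.sSup_le ?_ hb
  rintro r ⟨V, hV, hr⟩
  obtain ⟨φ, hφ, h1, h2⟩ := h V hV
  exact (hr φ hφ h1).trans h2

theorem exists_unit_of_finrank_pos {V : Submodule ℝ H} (h : 0 < Module.finrank ℝ V) :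
    ∃ φ ∈ V, ‖φ‖ = 1 := by
  obtain ⟨φ, h1, -, h2⟩ := exists_unit_mem_orthogonal (X := ⊥) (V := V) (by simpa using h)
  exact ⟨φ, h1, h2⟩

theorem inner_apply_le (T : H →L[ℝ] H) (x y : H) : |⟪T x, y⟫| ≤ ‖T‖ * ‖x‖ * ‖y‖ :=
  (abs_real_inner_le_norm _ _).trans (by gcongr; exact T.le_opNorm x)

theorem le_lamK {T : H →L[ℝ] H} {k : ℕ} (hk : 1 ≤ k) {V : Submodule ℝ H}
    (hV : k ≤ Module.finrank ℝ V) {r : ℝ} (h : ∀ φ ∈ V, ‖φ‖ = 1 → r ≤ ⟪T φ, φ⟫) :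
    r ≤ lamK T k := by
  have : FiniteDimensional ℝ V := Module.finite_of_finrank_pos (by omega)
  obtain ⟨X, -, hX, hXk⟩ := exists_finrank_eq_between (bot_le (a := V)) (n := k) (by simp) hV
  refine le_csSup ⟨‖T‖, ?_⟩ ⟨X, hXk, fun φ hφ => h φ (hX hφ)⟩
  rintro s ⟨W, hW, hs⟩
  obtain ⟨φ, hφ, h1⟩ := exists_unit_of_finrank_pos (V := W) (by omega)
  have := (le_abs_self _).trans (inner_apply_le T φ φ)
  rw [h1] at this
  linarith [hs φ hφ h1]

theorem lamK_eq_zero {T : H →L[ℝ] H} {k : ℕ}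
    (h : ¬ ∃ V : Submodule ℝ H, Module.finrank ℝ V = k) : lamK T k = 0 := by
  have : {r : ℝ | ∃ V : Submodule ℝ H, Module.finrank ℝ V = k ∧
      ∀ φ ∈ V, ‖φ‖ = 1 → r ≤ ⟪T φ, φ⟫} = ∅ := by
    ext r
    simp only [Set.mem_ofPred_eq, Set.mem_empty_iff_false, iff_false]
    rintro ⟨V, hV, -⟩
    exact h ⟨V, hV⟩
  rw [lamK, this, Real.sSup_empty]

theorem exists_finrank_eq_of_lamK_pos {T : H →L[ℝ] H} {k : ℕ} (h : 0 < lamK T k) :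
    ∃ V : Submodule ℝ H, Module.finrank ℝ V = k := by
  by_contra hne
  exact h.ne' (lamK_eq_zero hne)

/-- Comparison of quadratic forms gives comparison of Courant–Fischer values. -/
theorem lamK_le_affine {A B : H →L[ℝ] H} {k : ℕ} (hk : 1 ≤ k) {a b : ℝ} (ha : 0 < a)
    (hb : 0 ≤ b) (h : ∀ φ : H, ‖φ‖ = 1 → ⟪B φ, φ⟫ ≤ a * ⟪A φ, φ⟫ + b) :
    lamK B k ≤ a * lamK A k + b := by
  by_cases hne : ∃ V : Submodule ℝ H, Module.finrank ℝ V = k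
  · obtain ⟨V, hV⟩ := hne
    refine csSup_le ⟨-‖B‖, V, hV, fun φ _ h1 => ?_⟩ ?_
    · have := inner_apply_le B φ φ
      rw [h1] at this
      linarith [neg_abs_le ⟪B φ, φ⟫]
    · rintro r ⟨W, hW, hr⟩
      have : (r - b) / a ≤ lamK A k := le_lamK hk hW.ge fun φ hφ h1 => by
        rw [div_le_iff₀ ha]; linarith [hr φ hφ h1, h φ h1]
      rw [div_le_iff₀ ha] at this
      linarith
  · rw [lamK_eq_zero hne, lamK_eq_zero hne]
    linarith

theorem lamK_sub_le (A B : H →L[ℝ] H) {k : ℕ} (hk : 1 ≤ k) :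
    lamK A k - lamK B k ≤ ‖A - B‖ := by
  have := lamK_le_affine (A := B) (B := A) hk one_pos (norm_nonneg (A - B)) fun φ h1 => by
    have := (le_abs_self _).trans (inner_apply_le (A - B) φ φ)
    rw [h1, sub_apply, inner_sub_left] at this
    linarith
  linarith

theorem abs_lamK_sub_le (A B : H →L[ℝ] H) {k : ℕ} (hk : 1 ≤ k) :
    |lamK A k - lamK B k| ≤ ‖A - B‖ := by
  rw [abs_sub_le_iff]
  exact ⟨lamK_sub_le A B hk, norm_sub_rev A B ▸ lamK_sub_le B A hk⟩

theorem lamK_anti {A : H →L[ℝ] H} {k : ℕ} (hk : 1 ≤ k) (h : 0 < lamK A (k + 1)) :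
    lamK A (k + 1) ≤ lamK A k := by
  obtain ⟨V, hV⟩ := exists_finrank_eq_of_lamK_pos h
  refine csSup_le ⟨-‖A‖, V, hV, fun φ _ h1 => ?_⟩ ?_
  · have := inner_apply_le A φ φ
    rw [h1] at this
    linarith [neg_abs_le ⟪A φ, φ⟫]
  · rintro r ⟨W, hW, hr⟩
    exact le_lamK hk (by omega) hr

/-- Interlacing for a rank-one positive perturbation. -/
theorem lamK_add_rankOne_le {A B : H →L[ℝ] H} {u : H} {k : ℕ} (hk : 1 ≤ k)
    (h0 : 0 ≤ lamK A k) (hB : ∀ φ, ⟪u, φ⟫ = 0 → ⟪B φ, φ⟫ ≤ ⟪A φ, φ⟫) :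
    lamK B (k + 1) ≤ lamK A k := by
  refine Real.sSup_le ?_ h0
  rintro r ⟨V, hV, hr⟩
  have : FiniteDimensional ℝ V := Module.finite_of_finrank_pos (by omega)
  have hdim : k ≤ Module.finrank ℝ ((ℝ ∙ u)ᗮ ⊓ V : Submodule ℝ H) := by
    let f : V →ₗ[ℝ] ℝ := (innerSL ℝ u : H →ₗ[ℝ] ℝ) ∘ₗ V.subtype
    have h1 := f.finrank_range_add_finrank_ker
    have h2 : Module.finrank ℝ (LinearMap.range f) ≤ 1 := by
      simpa using Submodule.finrank_le (LinearMap.range f)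
    have h3 : (LinearMap.ker f).map V.subtype = (ℝ ∙ u)ᗮ ⊓ V := by
      ext x
      simp only [Submodule.mem_map, LinearMap.mem_ker, Submodule.mem_inf,
        Submodule.mem_orthogonal_singleton_iff_inner_right]
      exact ⟨by rintro ⟨y, hy, rfl⟩; exact ⟨hy, y.2⟩, fun ⟨hx, hx'⟩ => ⟨⟨x, hx'⟩, hx, rfl⟩⟩
    rw [← h3, Submodule.finrank_map_subtype_eq]
    omega
  refine le_lamK hk hdim fun φ hφ h1 => (hr φ hφ.2 h1).trans (hB φ ?_)
  exact Submodule.mem_orthogonal_singleton_iff_inner_right.1 hφ.1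

/-- Cauchy–Schwarz for the form of a symmetric operator that is nonnegative on an invariant
subspace. -/
theorem norm_apply_sq_le_of_form_nonneg {S : H →L[ℝ] H} (hS : ∀ x y, ⟪S x, y⟫ = ⟪x, S y⟫)
    {W : Submodule ℝ H} (hW : ∀ x ∈ W, S x ∈ W) (h0 : ∀ x ∈ W, 0 ≤ ⟪S x, x⟫) {x : H}
    (hx : x ∈ W) : ‖S x‖ ^ 2 ≤ ‖S‖ * ⟪S x, x⟫ := by
  rcases (norm_nonneg S).eq_or_lt with hN | hN
  · have : S = 0 := norm_eq_zero.1 hN.symm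
    simp [this]
  · have h1 := h0 _ (W.sub_mem hx (W.smul_mem (‖S‖⁻¹) (hW x hx)))
    have h2 := (le_abs_self _).trans (inner_apply_le S (S x) (S x))
    have h3 : ⟪S (S x), x⟫ = ‖S x‖ ^ 2 := by rw [hS, real_inner_self_eq_norm_sq]
    simp only [map_sub, map_smul, inner_sub_left, inner_sub_right, inner_smul_left,
      inner_smul_right, real_inner_self_eq_norm_sq, h3, conj_trivial] at h1
    have h4 : ‖S‖⁻¹ * (‖S‖⁻¹ * ⟪S (S x), S x⟫) ≤ ‖S‖⁻¹ * ‖S x‖ ^ 2 := by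
      refine mul_le_mul_of_nonneg_left ?_ (by positivity)
      rw [inv_mul_le_iff₀ hN]
      linarith [h2]
    have h5 : ‖S‖⁻¹ * ‖S x‖ ^ 2 ≤ ⟪S x, x⟫ := by linarith
    rwa [inv_mul_le_iff₀ hN] at h5

theorem exists_finrank_le_of_compact {A : H →L[ℝ] H} (hc : IsCompactOperator A) {c : ℝ}
    (h0 : 0 < c) : ∃ N : ℕ, ∀ V : Submodule ℝ H, (∀ x ∈ V, c * ‖x‖ ≤ ‖A x‖) →
      Module.finrank ℝ V ≤ N := by
  obtain ⟨K, hK, hKA⟩ :=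
    IsCompactOperator.image_closedBall_subset_compact (f := (A : H →ₗ[ℝ] H)) hc 1
  obtain ⟨t, -, htf, ht⟩ := hK.finite_cover_balls (half_pos h0)
  refine ⟨htf.toFinset.card, fun V hV => ?_⟩
  by_cases hf : Module.finrank ℝ V = 0
  · omega
  have : FiniteDimensional ℝ V := Module.finite_of_finrank_pos (by omega)
  let b := stdOrthonormalBasis ℝ V
  have hb1 : ∀ i, ‖(b i : H)‖ = 1 := b.norm_eq_one
  have hex : ∀ i, ∃ y ∈ t, dist (A (b i)) y < c / 2 := fun i => by
    have : A (b i) ∈ K := hKA ⟨b i, by simp [hb1], rfl⟩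
    simpa using ht this
  choose g hgt hg using hex
  have hinj : Function.Injective g := fun i j hij => by
    by_contra hne
    have h1 : dist (A (b i)) (A (b j)) < c := by
      calc _ ≤ dist (A (b i)) (g i) + dist (A (b j)) (g i) := dist_triangle_right _ _ _
        _ < c / 2 + c / 2 := add_lt_add (hg i) (hij ▸ hg j)
        _ = c := by ring
    have h2 := hV _ (V.sub_mem (b i).2 (b j).2)
    rw [map_sub, ← dist_eq_norm (A _)] at h2
    have h3 : ‖(b i : H) - b j‖ ^ 2 = 2 := by
      have : ⟪(b i : H), b j⟫ = 0 := b.inner_eq_zero hne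
      rw [@norm_sub_sq_real, hb1, hb1, this]
      norm_num
    have h4 : 1 < ‖(b i : H) - b j‖ := by
      nlinarith [norm_nonneg ((b i : H) - b j)]
    nlinarith
  calc Module.finrank ℝ V = Fintype.card (Fin (Module.finrank ℝ V)) := by simp
    _ ≤ htf.toFinset.card := by
      rw [← Finset.card_univ]
      exact Finset.card_le_card_of_injOn g (fun i _ => by simpa using hgt i) hinj.injOn

/-- If the form of a compact self-adjoint operator is not bounded below `c > 0` on a closed
invariant subspace, the subspace contains an eigenvector with eigenvalue at least `c`. -/
theorem exists_eigenvector_of_form {A : H →L[ℝ] H} (hA : ∀ x y, ⟪A x, y⟫ = ⟪x, A y⟫)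
    (hc : IsCompactOperator A) {W : Submodule ℝ H} (hWc : IsClosed (W : Set H))
    (hW : ∀ x ∈ W, A x ∈ W) {c : ℝ} (h0 : 0 < c)
    (h : ∀ c', 0 ≤ c' → c' < c → ∃ x ∈ W, c' * ‖x‖ ^ 2 < ⟪A x, x⟫) :
    ∃ x ∈ W, ‖x‖ = 1 ∧ ∃ μ, c ≤ μ ∧ A x = μ • x := by
  set R : Set ℝ := {r | ∃ x ∈ W, ‖x‖ = 1 ∧ r = ⟪A x, x⟫} with hR
  have hnorm : ∀ x ∈ W, x ≠ 0 → ∃ z ∈ W, ‖z‖ = 1 ∧ ⟪A x, x⟫ = ⟪A z, z⟫ * ‖x‖ ^ 2 :=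
    fun x hx hx0 => by
      refine ⟨‖x‖⁻¹ • x, W.smul_mem _ hx, norm_smul_inv_norm hx0, ?_⟩
      have : ‖x‖ ≠ 0 := norm_ne_zero_iff.2 hx0
      simp only [map_smul, inner_smul_left, inner_smul_right, conj_trivial]
      field_simp
  have hbdd : BddAbove R := ⟨‖A‖, by
    rintro r ⟨x, -, hx, rfl⟩
    simpa [hx] using (le_abs_self _).trans (inner_apply_le A x x)⟩
  have hne : R.Nonempty := by
    obtain ⟨x, hx, hlt⟩ := h 0 le_rfl h0
    obtain ⟨z, hz, hz1, -⟩ := hnorm x hx (by rintro rfl; simp at hlt)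
    exact ⟨_, z, hz, hz1, rfl⟩
  have hle : ∀ x ∈ W, ⟪A x, x⟫ ≤ sSup R * ‖x‖ ^ 2 := fun x hx => by
    by_cases hx0 : x = 0
    · simp [hx0]
    obtain ⟨z, hz, hz1, he⟩ := hnorm x hx hx0
    rw [he]
    gcongr
    exact le_csSup hbdd ⟨z, hz, hz1, rfl⟩
  set μ := sSup R with hμ
  have hcμ : c ≤ μ := by
    by_contra! hlt
    obtain ⟨x, hx, hx'⟩ := h (max μ 0) (le_max_right _ _) (max_lt hlt h0)
    have := hle x hx
    have h2 : μ * ‖x‖ ^ 2 ≤ max μ 0 * ‖x‖ ^ 2 := by gcongr; exact le_max_left _ _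
    linarith
  have hμ0 : 0 < μ := h0.trans_le hcμ
  obtain ⟨r, -, hr, hrR⟩ := exists_seq_tendsto_sSup hne hbdd
  choose x hxW hx1 hxr using hrR
  obtain ⟨K, hK, hKA⟩ :=
    IsCompactOperator.image_closedBall_subset_compact (f := (A : H →ₗ[ℝ] H)) hc 1
  obtain ⟨y, -, φ, hφ, hy⟩ := hK.tendsto_subseq
    (fun n => hKA ⟨x n, by simp [hx1], rfl⟩ : ∀ n, A (x n) ∈ K)
  set S : H →L[ℝ] H := μ • ContinuousLinearMap.id ℝ H - A with hSdef
  have hSx : ∀ z, S z = μ • z - A z := fun z => by simp [hSdef]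
  have hform : ∀ z, ⟪S z, z⟫ = μ * ‖z‖ ^ 2 - ⟪A z, z⟫ := fun z => by
    rw [hSx, inner_sub_left, real_inner_smul_left, real_inner_self_eq_norm_sq]
  have hSn : Tendsto (fun n => S (x n)) atTop (𝓝 0) := by
    have h1 : ∀ n, ‖S (x n)‖ ^ 2 ≤ ‖S‖ * (μ - r n) := fun n => by
      have := norm_apply_sq_le_of_form_nonneg (S := S) (W := W)
        (fun u v => by
          simp only [hSx, inner_sub_left, inner_sub_right, real_inner_smul_left,
            real_inner_smul_right, hA])
        (fun u hu => by rw [hSx]; exact W.sub_mem (W.smul_mem _ hu) (hW u hu))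
        (fun u hu => by rw [hform]; linarith [hle u hu]) (hxW n)
      rwa [hform, hx1, ← hxr, one_pow, mul_one] at this
    have h2 : Tendsto (fun n => ‖S‖ * (μ - r n)) atTop (𝓝 0) := by
      have := (hr.const_sub μ).const_mul ‖S‖
      rwa [← hμ, sub_self, mul_zero] at this
    have h3 := squeeze_zero (fun n => by positivity) h1 h2
    rw [tendsto_zero_iff_norm_tendsto_zero]
    simpa [Real.sqrt_sq (norm_nonneg _)] using h3.sqrt
  have hlim : Tendsto (fun n => x (φ n)) atTop (𝓝 (μ⁻¹ • y)) := by
    have h1 := ((hSn.comp hφ.tendsto_atTop).add hy).const_smul μ⁻¹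
    rw [zero_add] at h1
    refine h1.congr fun n => ?_
    simp [hSx, smul_smul, hμ0.ne']
  refine ⟨μ⁻¹ • y, hWc.mem_of_tendsto hlim (Eventually.of_forall fun n => hxW _), ?_, μ, hcμ, ?_⟩
  · exact tendsto_nhds_unique hlim.norm (by simp [hx1])
  · have h1 := (S.continuous.tendsto _).comp hlim
    have h2 := tendsto_nhds_unique h1 (hSn.comp hφ.tendsto_atTop)
    rw [hSx, sub_eq_zero] at h2
    exact h2.symm

/-- A finite-dimensional `A`-invariant subspace on which the form of `A` is at least `c`. -/
structure IsUpperInvariant (A : H →L[ℝ] H) (c : ℝ) (V : Submodule ℝ H) : Prop where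
  finite : FiniteDimensional ℝ V
  invariant : ∀ x ∈ V, A x ∈ V
  le_form : ∀ x ∈ V, c * ‖x‖ ^ 2 ≤ ⟪A x, x⟫

theorem isUpperInvariant_bot (A : H →L[ℝ] H) (c : ℝ) : IsUpperInvariant A c ⊥ :=
  ⟨inferInstance, by simp, by simp⟩

theorem orthogonal_invariant {A : H →L[ℝ] H} (hA : ∀ x y, ⟪A x, y⟫ = ⟪x, A y⟫)
    {V : Submodule ℝ H} (hV : ∀ x ∈ V, A x ∈ V) {x : H} (hx : x ∈ Vᗮ) : A x ∈ Vᗮ := by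
  rw [Submodule.mem_orthogonal] at hx ⊢
  intro u hu
  rw [← hA]
  exact hx _ (hV u hu)

/-- The form of `A` splits along an invariant subspace. -/
theorem form_add {A : H →L[ℝ] H} (hA : ∀ x y, ⟪A x, y⟫ = ⟪x, A y⟫)
    {V : Submodule ℝ H} (hV : ∀ x ∈ V, A x ∈ V) {p q : H} (hp : p ∈ V) (hq : q ∈ Vᗮ) :
    ⟪A (p + q), p + q⟫ = ⟪A p, p⟫ + ⟪A q, q⟫ := by
  have h1 : ⟪A p, q⟫ = 0 := Submodule.inner_right_of_mem_orthogonal (hV p hp) hq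
  have h2 : ⟪A q, p⟫ = 0 := by rw [hA, real_inner_comm, h1]
  rw [map_add, inner_add_left, inner_add_right, inner_add_right, h1, h2]
  ring

theorem norm_add_sq_of_mem_orthogonal {V : Submodule ℝ H} {p q : H} (hp : p ∈ V) (hq : q ∈ Vᗮ) :
    ‖p + q‖ ^ 2 = ‖p‖ ^ 2 + ‖q‖ ^ 2 := by
  rw [@norm_add_sq_real, Submodule.inner_right_of_mem_orthogonal hp hq]
  ring

theorem IsUpperInvariant.sup_span {A : H →L[ℝ] H} (hA : ∀ x y, ⟪A x, y⟫ = ⟪x, A y⟫) {c μ : ℝ}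
    {V : Submodule ℝ H} (hV : IsUpperInvariant A c V) {x : H} (hx : x ∈ Vᗮ) (hμ : c ≤ μ)
    (hAx : A x = μ • x) : IsUpperInvariant A c (V ⊔ ℝ ∙ x) := by
  have := hV.finite
  refine ⟨inferInstance, fun z hz => ?_, fun z hz => ?_⟩ <;>
    obtain ⟨p, hp, q, hq, rfl⟩ := Submodule.mem_sup.1 hz <;>
    obtain ⟨a, rfl⟩ := Submodule.mem_span_singleton.1 hq
  · rw [map_add, map_smul, hAx, smul_comm]
    exact Submodule.add_mem_sup (hV.invariant p hp) (Submodule.smul_mem _ _ hq)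
  · have hq' : a • x ∈ Vᗮ := Submodule.smul_mem _ _ hx
    rw [form_add hA hV.invariant hp hq', norm_add_sq_of_mem_orthogonal hp hq', map_smul, hAx,
      smul_comm, real_inner_smul_left, real_inner_self_eq_norm_sq]
    nlinarith [hV.le_form p hp, sq_nonneg ‖a • x‖]

/-- Every upper invariant subspace extends to one outside which the form of the compact
self-adjoint operator `A` stays strictly below `c`. -/
theorem IsUpperInvariant.exists_ge {A : H →L[ℝ] H} (hA : ∀ x y, ⟪A x, y⟫ = ⟪x, A y⟫)
    (hc : IsCompactOperator A) {c : ℝ} (h0 : 0 < c) {V₀ : Submodule ℝ H}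
    (hV₀ : IsUpperInvariant A c V₀) :
    ∃ V, V₀ ≤ V ∧ IsUpperInvariant A c V ∧
      ∃ c', 0 ≤ c' ∧ c' < c ∧ ∀ x ∈ Vᗮ, ⟪A x, x⟫ ≤ c' * ‖x‖ ^ 2 := by
  obtain ⟨N, hN⟩ := exists_finrank_le_of_compact hc h0
  have hbound : ∀ V, IsUpperInvariant A c V → Module.finrank ℝ V ≤ N := fun V hV =>
    hN V fun x hx => by
      rcases eq_or_ne x 0 with rfl | hx0
      · simp
      have h1 := (hV.le_form x hx).trans (real_inner_le_norm _ _)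
      have h2 := norm_pos_iff.2 hx0
      refine le_of_mul_le_mul_right ?_ h2
      linarith [h1]
  induction hn : N - Module.finrank ℝ V₀ using Nat.strong_induction_on generalizing V₀ with
  | _ n ih =>
    by_cases hV : ∃ c', 0 ≤ c' ∧ c' < c ∧ ∀ x ∈ V₀ᗮ, ⟪A x, x⟫ ≤ c' * ‖x‖ ^ 2
    · exact ⟨V₀, le_rfl, hV₀, hV⟩
    push Not at hV
    obtain ⟨x, hx, hx1, μ, hμ, hAx⟩ := exists_eigenvector_of_form hA hc
      (Submodule.isClosed_orthogonal V₀) (fun x hx => orthogonal_invariant hA hV₀.invariant hx)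
      h0 hV
    have hup := hV₀.sup_span hA hx hμ hAx
    have hlt : V₀ < V₀ ⊔ ℝ ∙ x := lt_of_le_of_ne le_sup_left fun he => by
      have hxV : x ∈ V₀ :=
        he ▸ (le_sup_right : ℝ ∙ x ≤ V₀ ⊔ ℝ ∙ x) (Submodule.mem_span_singleton_self x)
      have := Submodule.inner_right_of_mem_orthogonal hxV hx
      rw [real_inner_self_eq_norm_sq, hx1] at this
      norm_num at this
    have := hup.finite
    have h1 := Submodule.finrank_lt_finrank_of_lt hlt
    have h2 := hbound _ hup
    obtain ⟨V, hle, hV'⟩ := ih _ (by omega) hup rfl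
    exact ⟨V, hlt.le.trans hle, hV'⟩

theorem lamK_le_of_finrank_lt {A : H →L[ℝ] H} {X : Submodule ℝ H} [FiniteDimensional ℝ X]
    {k : ℕ} (hX : Module.finrank ℝ X < k) {c : ℝ} (h0 : 0 ≤ c)
    (h : ∀ x ∈ Xᗮ, ⟪A x, x⟫ ≤ c * ‖x‖ ^ 2) : lamK A k ≤ c := by
  refine lamK_le h0 fun V hV => ?_
  obtain ⟨φ, hφV, hφX, h1⟩ := exists_unit_mem_orthogonal (X := X) (V := V) (by omega)
  exact ⟨φ, hφV, h1, by simpa [h1] using h φ hφX⟩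

theorem le_lamK_of_form {A : H →L[ℝ] H} {X : Submodule ℝ H} {k : ℕ} (hk : 1 ≤ k)
    (hX : k ≤ Module.finrank ℝ X) {c : ℝ} (h : ∀ x ∈ X, c * ‖x‖ ^ 2 ≤ ⟪A x, x⟫) :
    c ≤ lamK A k :=
  le_lamK hk hX fun φ hφ h1 => by simpa [h1] using h φ hφ

theorem finrank_sup_span_of_mem_orthogonal {X : Submodule ℝ H} [FiniteDimensional ℝ X] {x : H}
    (hx : x ∈ Xᗮ) (hx0 : x ≠ 0) :
    Module.finrank ℝ X + 1 ≤ Module.finrank ℝ (X ⊔ ℝ ∙ x : Submodule ℝ H) := by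
  refine Submodule.finrank_lt_finrank_of_lt (lt_of_le_of_ne le_sup_left fun he => hx0 ?_)
  have hxV : x ∈ X :=
    he ▸ (le_sup_right : ℝ ∙ x ≤ X ⊔ ℝ ∙ x) (Submodule.mem_span_singleton_self x)
  exact inner_self_eq_zero.1 (Submodule.inner_right_of_mem_orthogonal hxV hx : ⟪x, x⟫ = 0)

/-- A spectral gap above the `(n+1)`-st eigenvalue is realised by an invariant subspace of
dimension `n`. -/
theorem exists_gap_subspace {A : H →L[ℝ] H} (hA : ∀ x y, ⟪A x, y⟫ = ⟪x, A y⟫)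
    (hc : IsCompactOperator A) {n : ℕ} (hpos : 0 < lamK A (n + 1))
    (hgap : n = 0 ∨ lamK A (n + 1) < lamK A n) :
    ∃ (X : Submodule ℝ H) (c : ℝ), lamK A (n + 1) < c ∧ IsUpperInvariant A c X ∧
      Module.finrank ℝ X = n ∧ ∀ x ∈ Xᗮ, ⟪A x, x⟫ ≤ lamK A (n + 1) * ‖x‖ ^ 2 := by
  obtain ⟨X, c, hc, hX, hXn⟩ : ∃ (X : Submodule ℝ H) (c : ℝ), lamK A (n + 1) < c ∧
      IsUpperInvariant A c X ∧ Module.finrank ℝ X = n := by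
    rcases Nat.eq_zero_or_pos n with rfl | hn
    · exact ⟨⊥, lamK A (0 + 1) + 1, by linarith, isUpperInvariant_bot _ _, by simp⟩
    · have hlt := hgap.resolve_left hn.ne'
      obtain ⟨X, -, hX, c', h0, hc', hform⟩ := (isUpperInvariant_bot A (lamK A n)).exists_ge hA hc
        (hpos.trans hlt)
      have := hX.finite
      refine ⟨X, _, hlt, hX, le_antisymm ?_ ?_⟩
      · by_contra! h
        exact hlt.not_ge (le_lamK_of_form (by omega) h hX.le_form)
      · by_contra! h
        exact hc'.not_ge (lamK_le_of_finrank_lt h h0 hform)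
  refine ⟨X, c, hc, hX, hXn, fun x hx => ?_⟩
  by_contra! hlt
  have := hX.finite
  have hx0 : x ≠ 0 := by rintro rfl; simp at hlt
  have hx2 : 0 < ‖x‖ ^ 2 := by positivity
  have hρ : lamK A (n + 1) < ⟪A x, x⟫ / ‖x‖ ^ 2 := by rwa [lt_div_iff₀ hx2]
  set ρ := ⟪A x, x⟫ / ‖x‖ ^ 2 with hρdef
  have hρx : ⟪A x, x⟫ = ρ * ‖x‖ ^ 2 := by rw [hρdef]; field_simp
  refine (lt_min hc hρ).not_ge (le_lamK_of_form (X := X ⊔ ℝ ∙ x) (by omega) ?_ fun z hz => ?_)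
  · have := finrank_sup_span_of_mem_orthogonal hx hx0
    omega
  · obtain ⟨p, hp, q, hq, rfl⟩ := Submodule.mem_sup.1 hz
    obtain ⟨a, rfl⟩ := Submodule.mem_span_singleton.1 hq
    have hq' : a • x ∈ Xᗮ := Submodule.smul_mem _ _ hx
    rw [form_add hA hX.invariant hp hq', norm_add_sq_of_mem_orthogonal hp hq', map_smul,
      real_inner_smul_left, real_inner_smul_right, hρx, norm_smul, mul_pow, Real.norm_eq_abs,
      sq_abs, mul_add]
    have h1 : min c ρ * ‖p‖ ^ 2 ≤ c * ‖p‖ ^ 2 := by gcongr; exact min_le_left _ _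
    have h2 : min c ρ * (a ^ 2 * ‖x‖ ^ 2) ≤ ρ * (a ^ 2 * ‖x‖ ^ 2) := by
      gcongr; exact min_le_right _ _
    linarith [hX.le_form p hp]

/-- Second-order upper bound for the `k`-th eigenvalue along a line. -/
theorem lamK_add_smul_le {A v : H →L[ℝ] H} (hA : ∀ x y, ⟪A x, y⟫ = ⟪x, A y⟫)
    {X Y : Submodule ℝ H} [FiniteDimensional ℝ X] [FiniteDimensional ℝ Y] (hXY : X ≤ Y)
    (hY : ∀ x ∈ Y, A x ∈ Y) {k : ℕ} (hXk : Module.finrank ℝ X < k) {l c s : ℝ} (hl : 0 < l)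
    (hX : ∀ x ∈ Xᗮ, ⟪A x, x⟫ ≤ l * ‖x‖ ^ 2) (hc : c < l)
    (hYc : ∀ x ∈ Yᗮ, ⟪A x, x⟫ ≤ c * ‖x‖ ^ 2)
    (hs : ∀ x ∈ Xᗮ, x ∈ Y → ⟪v x, x⟫ ≤ s * ‖x‖ ^ 2) :
    ∃ C, ∀ᶠ τ in 𝓝[>] (0 : ℝ), lamK (A + τ • v) k ≤ l + τ * s + C * τ ^ 2 := by
  set N := ‖v‖ with hN
  set g := l - c with hg
  have hN0 : 0 ≤ N := norm_nonneg v
  have hg0 : 0 < g := sub_pos.2 hc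
  refine ⟨2 * N ^ 2 / g, ?_⟩
  have hsmall : ∀ r : ℝ, 0 < r → ∀ M : ℝ, ∀ᶠ τ in 𝓝[>] (0 : ℝ), τ * M < r := fun r hr M => by
    have : Tendsto (fun τ : ℝ => τ * M) (𝓝[>] 0) (𝓝 (0 * M)) :=
      (tendsto_id.mul_const M).mono_left nhdsWithin_le_nhds
    rw [zero_mul] at this
    exact this.eventually_lt_const hr
  filter_upwards [hsmall (g / 2) (half_pos hg0) (|s| + N), hsmall l hl |s|,
    self_mem_nhdsWithin] with τ h1 h2 hτ
  have hτ : 0 < τ := hτ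
  have hs1 := neg_abs_le s
  have hs2 := le_abs_self s
  refine lamK_le (by nlinarith [show 0 ≤ 2 * N ^ 2 / g * τ ^ 2 by positivity]) fun V hV => ?_
  obtain ⟨φ, hφV, hφX, hφ1⟩ := exists_unit_mem_orthogonal (X := X) (V := V) (by omega)
  refine ⟨φ, hφV, hφ1, ?_⟩
  obtain ⟨f, hf, y, hy, rfl⟩ := Submodule.exists_add_mem_mem_orthogonal (K := Y) φ
  have hfX : f ∈ Xᗮ := by
    have := Xᗮ.sub_mem hφX (Submodule.orthogonal_le hXY hy)
    rwa [add_sub_cancel_right] at this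
  have hn := norm_add_sq_of_mem_orthogonal hf hy
  rw [hφ1, one_pow] at hn
  have e1 := form_add hA hY hf hy
  have e2 := hX f hfX
  have e3 := hYc y hy
  have e4 := hs f hfX hf
  have e5 := (le_abs_self _).trans (inner_apply_le v f y)
  have e6 := (le_abs_self _).trans (inner_apply_le v y f)
  have e7 := (le_abs_self _).trans (inner_apply_le v y y)
  have e8 : ⟪v (f + y), f + y⟫ = ⟪v f, f⟫ + ⟪v f, y⟫ + ⟪v y, f⟫ + ⟪v y, y⟫ := by
    rw [map_add, inner_add_left, inner_add_right, inner_add_right]; ring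
  rw [add_apply, smul_apply, inner_add_left, real_inner_smul_left, e1, e8]
  set F := ‖f‖
  set G := ‖y‖
  have hF0 : 0 ≤ F := norm_nonneg f
  have hG0 : 0 ≤ G := norm_nonneg y
  have hF1 : F ≤ 1 := by nlinarith
  have h5 : N * F * G ≤ N * G := by
    have : N * G * F ≤ N * G * 1 := by gcongr
    linarith
  have h6 : ⟪v f, f⟫ + ⟪v f, y⟫ + ⟪v y, f⟫ + ⟪v y, y⟫ ≤ s + (|s| + N) * G ^ 2 + 2 * N * G := by
    have : s * F ^ 2 ≤ s + |s| * G ^ 2 := by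
      have : F ^ 2 = 1 - G ^ 2 := by linarith
      rw [this]; nlinarith [sq_nonneg G]
    linarith
  have h7 : ⟪A f, f⟫ + ⟪A y, y⟫ ≤ l - g * G ^ 2 := by
    have : F ^ 2 = 1 - G ^ 2 := by linarith
    rw [this] at e2; rw [hg]; linarith
  have h8 : 2 * τ * N * G ≤ g / 2 * G ^ 2 + 2 * N ^ 2 / g * τ ^ 2 := by
    have : g / 2 * G ^ 2 + 2 * N ^ 2 / g * τ ^ 2 - 2 * τ * N * G
        = (g * G - 2 * N * τ) ^ 2 / (2 * g) := by field_simp; ring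
    have h9 : 0 ≤ (g * G - 2 * N * τ) ^ 2 / (2 * g) := by positivity
    linarith
  have h10 := mul_le_mul_of_nonneg_left h6 hτ.le
  have h11 := mul_le_mul_of_nonneg_right h1.le (sq_nonneg G)
  linarith

/-- Second-order lower bound for the `(n+1)`-st eigenvalue, given a spectral gap above it. -/
theorem le_lamK_add_smul {A v : H →L[ℝ] H} (hA : ∀ x y, ⟪A x, y⟫ = ⟪x, A y⟫)
    {X : Submodule ℝ H} [FiniteDimensional ℝ X] {n : ℕ} (hXn : Module.finrank ℝ X = n)
    {l ε τ : ℝ} (hε : 0 < ε) (hX : ∀ x ∈ X, (l + ε) * ‖x‖ ^ 2 ≤ ⟪A x, x⟫) {φ : H}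
    (hφX : φ ∈ Xᗮ) (hφ1 : ‖φ‖ = 1) (hAφ : A φ = l • φ) (hτ : 0 ≤ τ) (hτv : τ * ‖v‖ ≤ ε / 4) :
    l + τ * ⟪v φ, φ⟫ - 2 * ‖v‖ ^ 2 / ε * τ ^ 2 ≤ lamK (A + τ • v) (n + 1) := by
  have hφ0 : φ ≠ 0 := by rintro rfl; simp at hφ1
  refine le_lamK (by omega) (V := X ⊔ ℝ ∙ φ)
    (hXn ▸ finrank_sup_span_of_mem_orthogonal hφX hφ0) fun z hz hz1 => ?_
  obtain ⟨p, hp, q, hq, rfl⟩ := Submodule.mem_sup.1 hz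
  obtain ⟨a, rfl⟩ := Submodule.mem_span_singleton.1 hq
  have hn := norm_add_sq_of_mem_orthogonal hp (Xᗮ.smul_mem a hφX)
  rw [hz1, norm_smul, hφ1, mul_one, Real.norm_eq_abs, sq_abs, one_pow] at hn
  have e0 : ⟪p, φ⟫ = 0 := Submodule.inner_right_of_mem_orthogonal hp hφX
  have e1 : ⟪A (p + a • φ), p + a • φ⟫ = ⟪A p, p⟫ + l * a ^ 2 := by
    have h1 : ⟪A p, φ⟫ = 0 := by rw [hA, hAφ, real_inner_smul_right, e0, mul_zero]
    have h2 : ⟪φ, p⟫ = 0 := by rw [real_inner_comm, e0]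
    simp only [map_add, map_smul, inner_add_left, inner_add_right, real_inner_smul_left,
      real_inner_smul_right, hAφ, h1, h2, real_inner_self_eq_norm_sq, hφ1]
    ring
  have e2 := hX p hp
  have e5 := (neg_abs_le _).trans' (neg_le_neg (inner_apply_le v p φ))
  have e6 := (neg_abs_le _).trans' (neg_le_neg (inner_apply_le v φ p))
  have e7 := (neg_abs_le _).trans' (neg_le_neg (inner_apply_le v p p))
  have e9 := (le_abs_self _).trans (inner_apply_le v φ φ)
  have e8 : ⟪v (p + a • φ), p + a • φ⟫
      = ⟪v p, p⟫ + a * (⟪v p, φ⟫ + ⟪v φ, p⟫) + a ^ 2 * ⟪v φ, φ⟫ := by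
    simp only [map_add, map_smul, inner_add_left, inner_add_right, real_inner_smul_left,
      real_inner_smul_right]
    ring
  have e10 : |⟪v p, φ⟫ + ⟪v φ, p⟫| ≤ 2 * ‖v‖ * ‖p‖ := by
    refine (abs_add_le _ _).trans ?_
    have h1 := inner_apply_le v p φ
    have h2 := inner_apply_le v φ p
    rw [hφ1] at h1 h2
    linarith
  rw [add_apply, smul_apply, inner_add_left, real_inner_smul_left, e1, e8]
  rw [hφ1] at e9
  set N := ‖v‖
  set P := ‖p‖
  set w := ⟪v φ, φ⟫
  have hN0 : 0 ≤ N := norm_nonneg v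
  have hP0 : 0 ≤ P := norm_nonneg p
  have ha : |a| ≤ 1 := by
    rw [abs_le]; constructor <;> nlinarith [sq_nonneg P]
  have h1 : -(2 * N * P) ≤ a * (⟪v p, φ⟫ + ⟪v φ, p⟫) := by
    refine (neg_abs_le _).trans' (neg_le_neg ?_)
    rw [abs_mul]
    calc _ ≤ 1 * (2 * N * P) := by gcongr
      _ = _ := one_mul _
  have h2 : w - N * P ^ 2 ≤ a ^ 2 * w := by
    have : a ^ 2 = 1 - P ^ 2 := by linarith
    rw [this]; nlinarith [sq_nonneg P]
  have h3 : w - 2 * N * P ^ 2 - 2 * N * P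
      ≤ ⟪v p, p⟫ + a * (⟪v p, φ⟫ + ⟪v φ, p⟫) + a ^ 2 * w := by linarith
  have h4 := mul_le_mul_of_nonneg_left h3 hτ
  have h5 : 2 * τ * N * P ≤ ε / 2 * P ^ 2 + 2 * N ^ 2 / ε * τ ^ 2 := by
    have : ε / 2 * P ^ 2 + 2 * N ^ 2 / ε * τ ^ 2 - 2 * τ * N * P
        = (ε * P - 2 * N * τ) ^ 2 / (2 * ε) := by field_simp; ring
    have h9 : 0 ≤ (ε * P - 2 * N * τ) ^ 2 / (2 * ε) := by positivity
    linarith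
  have h6 := mul_le_mul_of_nonneg_right hτv (sq_nonneg P)
  have h7 : a ^ 2 = 1 - P ^ 2 := by linarith
  rw [h7] at h4 ⊢
  linarith

section Subdifferential

variable {f : E → ℝ} {x : E}

theorem abs_quotient_le (hf : ∀ a b, |f a - f b| ≤ ‖a - b‖) (v : E) :
    ∀ᶠ p : E × ℝ in 𝓝 x ×ˢ 𝓝[>] (0 : ℝ), |(f (p.1 + p.2 • v) - f p.1) / p.2| ≤ ‖v‖ := by
  have : ∀ᶠ p : E × ℝ in 𝓝 x ×ˢ 𝓝[>] (0 : ℝ), 0 < p.2 :=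
    tendsto_snd.eventually self_mem_nhdsWithin
  filter_upwards [this] with p hp
  rw [abs_div, abs_of_pos hp, div_le_iff₀ hp]
  refine (hf _ _).trans ?_
  rw [add_sub_cancel_left, norm_smul, Real.norm_eq_abs, abs_of_pos hp, mul_comm]

theorem eventually_lt_of_clarkeDeriv_lt (hf : ∀ a b, |f a - f b| ≤ ‖a - b‖) {v : E} {c : ℝ}
    (h : clarkeDeriv f x v < c) :
    ∀ᶠ p : E × ℝ in 𝓝 x ×ˢ 𝓝[>] (0 : ℝ), (f (p.1 + p.2 • v) - f p.1) / p.2 < c :=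
  eventually_lt_of_limsup_lt h ⟨‖v‖, eventually_map.2 <|
    (abs_quotient_le hf v).mono fun _ hp => (le_abs_self _).trans hp⟩

theorem clarkeDeriv_le (hf : ∀ a b, |f a - f b| ≤ ‖a - b‖) {v : E} {c : ℝ}
    (h : ∀ᶠ p : E × ℝ in 𝓝 x ×ˢ 𝓝[>] (0 : ℝ), (f (p.1 + p.2 • v) - f p.1) / p.2 ≤ c) :
    clarkeDeriv f x v ≤ c := by
  refine limsup_le_of_le (IsBoundedUnder.isCoboundedUnder_le ⟨-‖v‖, eventually_map.2 ?_⟩) h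
  exact (abs_quotient_le hf v).mono fun _ hp => neg_le_of_abs_le hp

theorem le_of_mem_diniSubdiffOn {L : Submodule ℝ E} {η : E →L[ℝ] ℝ}
    (hη : η ∈ diniSubdiffOn f L x) {v : E} (hv : v ∈ L) {s C : ℝ}
    (h : ∀ᶠ τ in 𝓝[>] (0 : ℝ), f (x + τ • v) ≤ f x + τ * s + C * τ ^ 2) : η v ≤ s := by
  by_contra! hlt
  obtain ⟨c, hsc, hcη⟩ := exists_between hlt
  have h1 := eventually_lt_of_lt_liminf ((EReal.coe_lt_coe_iff.2 hcη).trans_le (hη v))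
  have h2 : ∀ᶠ τ in 𝓝[>] (0 : ℝ), (c : EReal) < ((f (x + τ • v) - f x) / τ : ℝ) :=
    h1.curry.self_of_nhdsWithin hv
  have h3 : Tendsto (fun τ : ℝ => s + C * τ) (𝓝[>] 0) (𝓝 (s + C * 0)) :=
    ((tendsto_id.const_mul C).const_add s).mono_left nhdsWithin_le_nhds
  rw [mul_zero, add_zero] at h3
  obtain ⟨τ, h4, h5, h6, h7⟩ :=
    (h.and (h2.and ((h3.eventually_lt_const hsc).and self_mem_nhdsWithin))).exists
  have h7 : 0 < τ := h7
  rw [EReal.coe_lt_coe_iff, lt_div_iff₀ h7] at h5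
  nlinarith

theorem mem_diniSubdiffOn {L : Submodule ℝ E} {ξ : E →L[ℝ] ℝ}
    (h : ∀ v, ∃ C, ∀ᶠ p : E × ℝ in 𝓝 v ×ˢ 𝓝[>] (0 : ℝ),
      f x + p.2 * ξ p.1 - C * p.2 ^ 2 ≤ f (x + p.2 • p.1)) : ξ ∈ diniSubdiffOn f L x := by
  intro v
  refine le_of_forall_lt fun r hr => ?_
  obtain ⟨c, hrc, hcξ⟩ := EReal.lt_iff_exists_real_btwn.1 hr
  refine hrc.trans_le (le_liminf_of_le (by isBoundedDefault) ?_)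
  obtain ⟨C, hC⟩ := h v
  have h1 : Tendsto (fun p : E × ℝ => ξ p.1 - C * p.2) (𝓝 v ×ˢ 𝓝[>] 0) (𝓝 (ξ v - C * 0)) :=
    ((ξ.continuous.tendsto v).comp tendsto_fst).sub
      (((tendsto_id.mono_left nhdsWithin_le_nhds).comp tendsto_snd).const_mul C)
  rw [mul_zero, sub_zero] at h1
  have h2 : ∀ᶠ p : E × ℝ in 𝓝 v ×ˢ 𝓝[>] (0 : ℝ), 0 < p.2 :=
    tendsto_snd.eventually self_mem_nhdsWithin
  have h3 : ∀ᶠ p : E × ℝ in 𝓝 v ×ˢ 𝓝[>] (0 : ℝ), c ≤ (f (x + p.2 • p.1) - f x) / p.2 := by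
    filter_upwards [hC, h2, h1.eventually_const_lt (EReal.coe_lt_coe_iff.1 hcξ)] with p h4 h5 h6
    rw [le_div_iff₀ h5]
    nlinarith
  exact (h3.filter_mono (prod_mono nhdsWithin_le_nhds le_rfl)).mono
    fun p hp => EReal.coe_le_coe_iff.2 hp

theorem approxSubdiff_subset_clarkeSubdiff (hf : ∀ a b, |f a - f b| ≤ ‖a - b‖) :
    approxSubdiff f x ⊆ clarkeSubdiff f x := by
  intro ξ hξ v
  refine le_of_forall_gt_imp_ge_of_dense fun c hc => le_of_forall_pos_le_add fun ε hε => ?_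
  obtain ⟨U, hU, W, hW, hUW⟩ := eventually_prod_iff.1 (eventually_lt_of_clarkeDeriv_lt hf hc)
  obtain ⟨y, hy, -, η, hη, hηξ⟩ := hξ (ℝ ∙ v) inferInstance {v} ε hε 1 one_pos _ hU
  have h1 : η v ≤ c := le_of_mem_diniSubdiffOn hη
      (Submodule.mem_span_singleton_self v) (C := 0) <| by
    filter_upwards [hW, self_mem_nhdsWithin] with τ hτ hτ0
    have hτ0 : 0 < τ := hτ0
    have := hUW hy hτ
    rw [div_lt_iff₀ hτ0] at this
    linarith
  have h2 := abs_lt.1 (hηξ v (by simp))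
  linarith

end Subdifferential

/-- A finite sum of squares on a subspace of dimension at most `m` is a sum of `m` squares. -/
theorem exists_fin_sum_form_eq {F : Submodule ℝ H} [FiniteDimensional ℝ F] {m : ℕ}
    (hm : Module.finrank ℝ F ≤ m) {J : Type*} [Fintype J] {φ : J → H} (hφ : ∀ j, φ j ∈ F) :
    ∃ ψ : Fin m → H, (∀ i, ψ i ∈ F) ∧
      ∀ S : H →L[ℝ] H, ∑ j, ⟪S (φ j), φ j⟫ = ∑ i, ⟪S (ψ i), ψ i⟫ := by
  set n := Module.finrank ℝ F with hn
  suffices h : ∃ ψ : Fin n → H, (∀ i, ψ i ∈ F) ∧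
      ∀ S : H →L[ℝ] H, ∑ j, ⟪S (φ j), φ j⟫ = ∑ i, ⟪S (ψ i), ψ i⟫ by
    obtain ⟨ψ, hψ, hS⟩ := h
    obtain ⟨d, rfl⟩ := Nat.exists_eq_add_of_le hm
    refine ⟨Fin.append ψ 0, fun i => ?_, fun S => ?_⟩
    · induction i using Fin.addCases with
      | left i => simpa using hψ i
      | right i => simp
    · rw [hS, Fin.sum_univ_add]
      simp
  let φ' : J → F := fun j => ⟨φ j, hφ j⟩
  let A : F →ₗ[ℝ] F := ∑ j, (InnerProductSpace.rankOne ℝ (φ' j) (φ' j) : F →ₗ[ℝ] F)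
  have hAx : ∀ x, A x = ∑ j, ⟪φ' j, x⟫ • φ' j := fun x => by simp [A]
  have hA : A.IsSymmetric := fun x y => by
    simp only [hAx, sum_inner, inner_sum, real_inner_smul_left, real_inner_smul_right]
    exact Finset.sum_congr rfl fun j _ => by rw [real_inner_comm (φ' j) x, mul_comm]
  let b := hA.eigenvectorBasis hn.symm
  let μ := hA.eigenvalues hn.symm
  have hb : ∀ a, A (b a) = μ a • b a := fun a => hA.apply_eigenvectorBasis hn.symm a
  have hab : ∀ a c, ∑ j, ⟪φ' j, b a⟫ * ⟪φ' j, b c⟫ = if a = c then μ a else 0 := fun a c => by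
    have h1 : ⟪A (b a), b c⟫ = ∑ j, ⟪φ' j, b a⟫ * ⟪φ' j, b c⟫ := by
      simp only [hAx, sum_inner, real_inner_smul_left]
    rw [← h1, hb, real_inner_smul_left, orthonormal_iff_ite.1 b.orthonormal a c]
    simp
  have hμ : ∀ a, 0 ≤ μ a := fun a => by
    have h1 := hab a a
    rw [if_pos rfl] at h1
    rw [← h1]
    exact Finset.sum_nonneg fun j _ => mul_self_nonneg _
  refine ⟨fun a => √(μ a) • (b a : H), fun a => F.smul_mem _ (b a).2, fun S => ?_⟩
  have hexp : ∀ j, φ j = ∑ a, ⟪φ' j, b a⟫ • (b a : H) := fun j => by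
    have h1 := congrArg (Subtype.val : F → H) (b.sum_repr' (φ' j))
    simp only [Submodule.coe_sum, Submodule.coe_smul] at h1
    rw [show φ j = (φ' j : H) from rfl, ← h1]
    exact Finset.sum_congr rfl fun a _ => by rw [real_inner_comm]
  calc ∑ j, ⟪S (φ j), φ j⟫
      = ∑ j, ∑ a, ∑ c, ⟪φ' j, b a⟫ * ⟪φ' j, b c⟫ * ⟪S (b a), b c⟫ := by
        refine Finset.sum_congr rfl fun j _ => ?_
        conv_lhs => rw [hexp j]
        simp only [map_sum, map_smul, sum_inner, inner_sum, real_inner_smul_left,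
          real_inner_smul_right]
        rw [Finset.sum_comm]
        exact Finset.sum_congr rfl fun a _ => Finset.sum_congr rfl fun c _ => by ring
    _ = ∑ a, ∑ c, (∑ j, ⟪φ' j, b a⟫ * ⟪φ' j, b c⟫) * ⟪S (b a), b c⟫ := by
        rw [Finset.sum_comm]
        refine Finset.sum_congr rfl fun a _ => ?_
        rw [Finset.sum_comm]
        exact Finset.sum_congr rfl fun c _ => by rw [Finset.sum_mul]
    _ = ∑ a, ⟪S (√(μ a) • (b a : H)), √(μ a) • (b a : H)⟫ := by
        refine Finset.sum_congr rfl fun a _ => ?_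
        simp only [hab, ite_mul, zero_mul, Finset.sum_ite_eq, Finset.mem_univ, if_true, map_smul,
          real_inner_smul_left, real_inner_smul_right]
        rw [← mul_assoc, Real.mul_self_sqrt (hμ a)]

/-- A functional dominated by the largest eigenvalue of the compression to `F` is, on a finite
set of operators, approximately a sum of `m ≥ dim F` squares. -/
theorem exists_approx_form {F : Submodule ℝ H} [FiniteDimensional ℝ F] {m : ℕ}
    (hm : Module.finrank ℝ F ≤ m) (s : Finset (Ksa H)) (η : Ksa H →L[ℝ] ℝ)
    (h : ∀ v ∈ Submodule.span ℝ (s : Set (Ksa H)), ∀ c : ℝ,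
      (∀ φ ∈ F, ⟪(v : H →L[ℝ] H) φ, φ⟫ ≤ c * ‖φ‖ ^ 2) → η v ≤ c) {ε : ℝ} (hε : 0 < ε) :
    ∃ ψ : Fin m → H, (∀ i, ψ i ∈ F) ∧ (∀ i, ‖ψ i‖ ≤ 1) ∧
      ∀ v ∈ s, |η v - ∑ i, ⟪(v : H →L[ℝ] H) (ψ i), ψ i⟫| < ε := by
  classical
  let D : Set (s → ℝ) := {p | ∃ φ ∈ F, ‖φ‖ = 1 ∧ p = fun v => ⟪(v.1 : H →L[ℝ] H) φ, φ⟫}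
  have hmem : (fun v : s => η v) ∈ closure (convexHull ℝ D) := by
    by_contra hnot
    obtain ⟨g, u, hg, hu⟩ := geometric_hahn_banach_closed_point
      (convex_convexHull ℝ D).closure isClosed_closure hnot
    let e : s → ℝ := fun v => g fun w => if v = w then 1 else 0
    have hge : ∀ p, g p = ∑ v, p v * e v := fun p =>
      LinearMap.pi_apply_eq_sum_univ (g : (s → ℝ) →ₗ[ℝ] ℝ) p
    have h1 : η (∑ v : s, e v • (v : Ksa H)) ≤ u := by
      refine h _ (Submodule.sum_mem _ fun v _ =>
        Submodule.smul_mem _ _ (Submodule.subset_span v.2)) u fun φ hφ => ?_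
      have hform : ∀ z, ⟪((∑ v : s, e v • (v : Ksa H) : Ksa H) : H →L[ℝ] H) z, z⟫
          = g fun v => ⟪(v.1 : H →L[ℝ] H) z, z⟫ := fun z => by
        rw [hge]
        simp only [Submodule.coe_sum, Submodule.coe_smul, sum_apply, smul_apply, sum_inner,
          real_inner_smul_left]
        exact Finset.sum_congr rfl fun v _ => mul_comm _ _
      by_cases hφ0 : φ = 0
      · simp [hφ0]
      have hn : ‖φ‖ ≠ 0 := norm_ne_zero_iff.2 hφ0
      have h2 := hg _ (subset_closure (subset_convexHull ℝ D
        ⟨‖φ‖⁻¹ • φ, F.smul_mem _ hφ, norm_smul_inv_norm hφ0, rfl⟩))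
      rw [← hform, map_smul, real_inner_smul_left, real_inner_smul_right] at h2
      have h3 : ∀ r : ℝ, ‖φ‖⁻¹ * (‖φ‖⁻¹ * r) < u → r ≤ u * ‖φ‖ ^ 2 := fun r hr => by
        have h4 : r = ‖φ‖⁻¹ * (‖φ‖⁻¹ * r) * ‖φ‖ ^ 2 := by field_simp
        rw [h4]
        gcongr
      exact h3 _ h2
    rw [hge] at hu
    simp only [map_sum, map_smul, smul_eq_mul] at h1
    exact hu.not_ge (h1.trans_eq' (Finset.sum_congr rfl fun v _ => mul_comm _ _))
  obtain ⟨d, hd, hdε⟩ := Metric.mem_closure_iff.1 hmem ε hε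
  obtain ⟨J, _, w, z, hw0, hw1, hz, rfl⟩ := mem_convexHull_iff_exists_fintype.1 hd
  choose φ hφF hφ1 hzφ using hz
  obtain ⟨ψ, hψF, hψ⟩ := exists_fin_sum_form_eq hm (φ := fun j => √(w j) • φ j)
    fun j => F.smul_mem _ (hφF j)
  have hφS : ∀ S : H →L[ℝ] H, ∑ j, w j * ⟪S (φ j), φ j⟫ = ∑ i, ⟪S (ψ i), ψ i⟫ := fun S => by
    rw [← hψ S]
    refine Finset.sum_congr rfl fun j _ => ?_
    rw [map_smul, real_inner_smul_left, real_inner_smul_right, ← mul_assoc,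
      Real.mul_self_sqrt (hw0 j)]
  refine ⟨ψ, hψF, fun i => ?_, fun v hv => ?_⟩
  · have h1 := hφS (ContinuousLinearMap.id ℝ H)
    simp only [ContinuousLinearMap.id_apply, real_inner_self_eq_norm_sq, hφ1, one_pow, mul_one,
      hw1] at h1
    have h2 := Finset.single_le_sum (f := fun i => ‖ψ i‖ ^ 2) (fun i _ => sq_nonneg _)
      (Finset.mem_univ i)
    rw [← h1] at h2
    nlinarith [norm_nonneg (ψ i)]
  · have h1 := (dist_le_pi_dist _ _ (⟨v, hv⟩ : s)).trans_lt hdε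
    rw [Real.dist_eq, Finset.sum_apply] at h1
    simpa only [Pi.smul_apply, smul_eq_mul, hzφ, hφS] using h1

theorem apply_self_eq_of_mem_clarkeSubdiff {f : E → ℝ} {x : E}
    (hf : ∀ a b, |f a - f b| ≤ ‖a - b‖) (hhom : ∀ a : ℝ, 0 < a → ∀ y, f (a • y) ≤ a * f y)
    {ξ : E →L[ℝ] ℝ} (hξ : ξ ∈ clarkeSubdiff f x) : ξ x = f x := by
  have key : ∀ w : ℝ, |w| = 1 → w * ξ x ≤ w * f x := fun w hw => by
    refine le_of_forall_pos_le_add fun ε hε => ?_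
    have h1 : clarkeDeriv f x (w • x) ≤ w * f x + ε := by
      refine clarkeDeriv_le hf ?_
      have e1 : ∀ᶠ p : E × ℝ in 𝓝 x ×ˢ 𝓝[>] (0 : ℝ), ‖p.1 - x‖ < ε / 2 :=
        tendsto_fst.eventually (by
          filter_upwards [Metric.ball_mem_nhds x (half_pos hε)] with y hy
          rwa [Metric.mem_ball, dist_eq_norm] at hy)
      have e2 : ∀ᶠ p : E × ℝ in 𝓝 x ×ˢ 𝓝[>] (0 : ℝ), p.2 ∈ Set.Ioo (0 : ℝ) 1 :=
        tendsto_snd.eventually (Ioo_mem_nhdsGT one_pos)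
      filter_upwards [e1, e2] with ⟨y, τ⟩ hy hτ
      simp only at hy hτ ⊢
      obtain ⟨hτ0, hτ1⟩ := hτ
      rw [div_le_iff₀ hτ0]
      obtain ⟨hwl, hwu⟩ := abs_le.1 hw.le
      have ha : 0 < 1 + τ * w := by nlinarith
      have h2 := (abs_le.1 (hf (y + τ • w • x) ((1 + τ * w) • y))).2
      have h3 : y + τ • w • x - (1 + τ * w) • y = -(τ * w) • (y - x) := by
        rw [smul_smul, add_smul, one_smul, neg_smul, smul_sub]; abel
      rw [h3, norm_smul, norm_neg, norm_mul, Real.norm_eq_abs, Real.norm_eq_abs, hw,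
        abs_of_pos hτ0, mul_one] at h2
      have h4 := hhom _ ha y
      have h5 : w * f y ≤ w * f x + ‖y - x‖ := by
        have h6 := (le_abs_self (w * (f y - f x)))
        rw [abs_mul, hw, one_mul] at h6
        linarith [hf y x]
      nlinarith
    have h2 := hξ (w • x)
    rw [map_smul, smul_eq_mul] at h2
    exact h2.trans h1
  have h1 := key 1 (by simp)
  have h2 := key (-1) (by simp)
  linarith

namespace Ksa

theorem isSymmetric (A : Ksa H) (x y : H) :
    ⟪(A : H →L[ℝ] H) x, y⟫ = ⟪x, (A : H →L[ℝ] H) y⟫ :=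
  A.2.1.isSymmetric x y

theorem isCompactOperator (A : Ksa H) : IsCompactOperator (A : H →L[ℝ] H) := A.2.2

theorem isCompactOperator_of_finiteDimensional_range {A : H →L[ℝ] H} {V : Submodule ℝ H}
    [FiniteDimensional ℝ V] (h : ∀ x, A x ∈ V) : IsCompactOperator A :=
  (isCompactOperator_of_locallyCompactSpace_dom (A.codRestrict V h)).clm_comp V.subtypeL

/-- The rank-one operator `u ⊗ u`. -/
noncomputable def sq (u : H) : Ksa H :=
  ⟨InnerProductSpace.rankOne ℝ u u, (InnerProductSpace.isPositive_rankOne_self u).isSelfAdjoint,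
    isCompactOperator_of_finiteDimensional_range (V := ℝ ∙ u) fun x => by
      simpa using Submodule.smul_mem _ _ (Submodule.mem_span_singleton_self u)⟩

@[simp]
theorem sq_apply (u x : H) : (sq u : H →L[ℝ] H) x = ⟪u, x⟫ • u := by simp [sq]

/-- The orthogonal projection onto a finite-dimensional subspace. -/
noncomputable def proj (X : Submodule ℝ H) [FiniteDimensional ℝ X] : Ksa H :=
  ⟨X.starProjection, isSelfAdjoint_starProjection X,
    isCompactOperator_of_finiteDimensional_range (V := X) fun x => X.starProjection_apply_mem x⟩

theorem proj_apply_of_mem {X : Submodule ℝ H} [FiniteDimensional ℝ X] {x : H} (hx : x ∈ X) :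
    (proj X : H →L[ℝ] H) x = x :=
  Submodule.starProjection_eq_self_iff.2 hx

theorem proj_apply_of_mem_orthogonal {X : Submodule ℝ H} [FiniteDimensional ℝ X] {x : H}
    (hx : x ∈ Xᗮ) : (proj X : H →L[ℝ] H) x = 0 :=
  (Submodule.starProjection_apply_eq_zero_iff X).2 hx

theorem proj_inner_self (X : Submodule ℝ H) [FiniteDimensional ℝ X] (x : H) :
    ⟪(proj X : H →L[ℝ] H) x, x⟫ = ‖(proj X : H →L[ℝ] H) x‖ ^ 2 := by
  have h1 : (proj X : H →L[ℝ] H) ((proj X : H →L[ℝ] H) x) = (proj X : H →L[ℝ] H) x :=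
    proj_apply_of_mem (X.starProjection_apply_mem x)
  conv_lhs => rw [← h1, isSymmetric, real_inner_self_eq_norm_sq]

theorem abs_lamK_sub_le (A B : Ksa H) {k : ℕ} (hk : 1 ≤ k) :
    |lamK (A : H →L[ℝ] H) k - lamK (B : H →L[ℝ] H) k| ≤ ‖A - B‖ :=
  _root_.abs_lamK_sub_le (A : H →L[ℝ] H) B hk

end Ksa

theorem apply_self_eq_lamK {T : Ksa H} {k : ℕ} (hk : 1 ≤ k) {ξ : Ksa H →L[ℝ] ℝ}
    (hξ : ξ ∈ clarkeSubdiff (fun S : Ksa H => lamK (S : H →L[ℝ] H) k) T) :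
    ξ T = lamK (T : H →L[ℝ] H) k := by
  refine apply_self_eq_of_mem_clarkeSubdiff (f := fun S : Ksa H => lamK (S : H →L[ℝ] H) k)
    (fun A B => Ksa.abs_lamK_sub_le A B hk) (fun a ha S => ?_) hξ
  have := lamK_le_affine (A := (S : H →L[ℝ] H)) (B := ((a • S : Ksa H) : H →L[ℝ] H)) hk ha le_rfl
    fun φ _ => by simp [real_inner_smul_left]
  simpa using this

/-- A positive compact operator is approximated by finite sums of operators `u ⊗ u`. -/
theorem exists_sum_sq_approx (T : Ksa H) (hpos : ∀ φ : H, 0 ≤ ⟪(T : H →L[ℝ] H) φ, φ⟫) {ε : ℝ}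
    (hε : 0 < ε) : ∃ (n : ℕ) (u : Fin n → H), ‖T - ∑ a, Ksa.sq (u a)‖ ≤ ε := by
  set A : H →L[ℝ] H := (T : H →L[ℝ] H) with hAdef
  set c := ε ^ 2 / (‖A‖ + 1) with hcdef
  have hA1 : 0 < ‖A‖ + 1 := by positivity
  have hc0 : 0 < c := by positivity
  obtain ⟨P, -, hP, c', hc'0, hc', hform⟩ :=
    (isUpperInvariant_bot A c).exists_ge (Ksa.isSymmetric T) (Ksa.isCompactOperator T) hc0
  have := hP.finite
  let B : P →ₗ[ℝ] P := (A : H →ₗ[ℝ] H).restrict hP.invariant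
  have hB : B.IsSymmetric := fun x y => (Ksa.isSymmetric T) x y
  let b := hB.eigenvectorBasis rfl
  let μ := hB.eigenvalues rfl
  have hb : ∀ a, A (b a) = μ a • (b a : H) := fun a =>
    congrArg (Subtype.val : P → H) (hB.apply_eigenvectorBasis rfl a)
  have hμ : ∀ a, 0 ≤ μ a := fun a => by
    have h1 := hpos (b a)
    rw [hb, real_inner_smul_left, real_inner_self_eq_norm_sq] at h1
    have h2 : ‖(b a : H)‖ = 1 := b.orthonormal.1 a
    simpa [h2] using h1
  refine ⟨_, fun a => √(μ a) • (b a : H), ContinuousLinearMap.opNorm_le_bound _ hε.le fun x => ?_⟩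
  obtain ⟨p, hp, q, hq, rfl⟩ := Submodule.mem_sup.1
    ((Submodule.sup_orthogonal_of_hasOrthogonalProjection (K := P)).symm ▸ Submodule.mem_top :
      x ∈ P ⊔ Pᗮ)
  have hsq : ∀ y : H, ((∑ a, Ksa.sq (√(μ a) • (b a : H)) : Ksa H) : H →L[ℝ] H) y
      = ∑ a, ⟪(b a : H), y⟫ • μ a • (b a : H) := fun y => by
    simp only [Submodule.coe_sum, sum_apply, Ksa.sq_apply, real_inner_smul_left, smul_smul]
    refine Finset.sum_congr rfl fun a _ => ?_
    rw [mul_right_comm, Real.mul_self_sqrt (hμ a), mul_comm]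
  have hpA : A p = ∑ a, ⟪(b a : H), p⟫ • μ a • (b a : H) := by
    have h1 : p = ∑ a, ⟪(b a : H), p⟫ • (b a : H) := by
      have h2 := congrArg (Subtype.val : P → H) (b.sum_repr' ⟨p, hp⟩)
      simpa only [Submodule.coe_sum, Submodule.coe_smul, Submodule.coe_inner] using h2.symm
    conv_lhs => rw [h1]
    simp only [map_sum, map_smul, hb]
  have hq0 : ∀ a, ⟪(b a : H), q⟫ = 0 := fun a =>
    Submodule.inner_right_of_mem_orthogonal (b a).2 hq
  have hval : ((T - ∑ a, Ksa.sq (√(μ a) • (b a : H)) : Ksa H) : H →L[ℝ] H) (p + q) = A q := by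
    rw [Submodule.coe_sub, sub_apply, hsq, ← hAdef, map_add, hpA]
    simp only [inner_add_right, hq0, add_zero, add_sub_cancel_left]
  refine (congrArg norm hval).trans_le (abs_le_of_sq_le_sq' ?_ (by positivity)).2
  have h1 := norm_apply_sq_le_of_form_nonneg (S := A) (Ksa.isSymmetric T) (W := ⊤) (by simp)
    (fun x _ => hpos x) (x := q) trivial
  have h2 : ‖A‖ * ⟪A q, q⟫ ≤ ε ^ 2 * ‖q‖ ^ 2 := by
    have h3 : ⟪A q, q⟫ ≤ c * ‖q‖ ^ 2 := (hform q hq).trans (by gcongr)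
    calc ‖A‖ * ⟪A q, q⟫ ≤ (‖A‖ + 1) * (c * ‖q‖ ^ 2) :=
          mul_le_mul (by linarith) h3 (hpos q) hA1.le
      _ = ε ^ 2 * ‖q‖ ^ 2 := by rw [hcdef]; field_simp
  have h4 := norm_add_sq_of_mem_orthogonal hp hq
  rw [mul_pow, h4]
  nlinarith [sq_nonneg ‖p‖, sq_nonneg ε, mul_nonneg (sq_nonneg ε) (sq_nonneg ‖p‖)]

theorem exists_pos_bound (ξ : E →L[ℝ] ℝ) : ∃ M, 0 < M ∧ ∀ x, |ξ x| ≤ M * ‖x‖ :=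
  ⟨‖ξ‖ + 1, by positivity, fun x => (ξ.le_opNorm x).trans (by gcongr; linarith)⟩

theorem IsUpperInvariant.mono {A : H →L[ℝ] H} {c d : ℝ} {V : Submodule ℝ H}
    (hV : IsUpperInvariant A d V) (h : c ≤ d) : IsUpperInvariant A c V :=
  ⟨hV.finite, hV.invariant, fun x hx => (by gcongr : c * ‖x‖ ^ 2 ≤ d * ‖x‖ ^ 2).trans
    (hV.le_form x hx)⟩

/-- If the form of `A` is at most `l` on an invariant subspace, vectors where it attains `l`
are eigenvectors. -/
theorem apply_eq_smul_of_form_le {A : H →L[ℝ] H} (hA : ∀ x y, ⟪A x, y⟫ = ⟪x, A y⟫)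
    {W : Submodule ℝ H} (hW : ∀ x ∈ W, A x ∈ W) {l : ℝ}
    (h : ∀ x ∈ W, ⟪A x, x⟫ ≤ l * ‖x‖ ^ 2) {x : H} (hx : x ∈ W)
    (hxl : l * ‖x‖ ^ 2 ≤ ⟪A x, x⟫) : A x = l • x := by
  let S : H →L[ℝ] H := l • ContinuousLinearMap.id ℝ H - A
  have hS : ∀ y, S y = l • y - A y := fun y => by simp [S]
  have hform : ∀ y, ⟪S y, y⟫ = l * ‖y‖ ^ 2 - ⟪A y, y⟫ := fun y => by
    rw [hS, inner_sub_left, real_inner_smul_left, real_inner_self_eq_norm_sq]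
  have h1 := norm_apply_sq_le_of_form_nonneg (S := S) (W := W) (x := x)
    (fun y z => by
      simp only [hS, inner_sub_left, inner_sub_right, real_inner_smul_left,
        real_inner_smul_right, hA])
    (fun y hy => by rw [hS]; exact W.sub_mem (W.smul_mem _ hy) (hW y hy))
    (fun y hy => by rw [hform]; linarith [h y hy]) hx
  have h2 : ⟪S x, x⟫ ≤ 0 := by rw [hform]; linarith
  have h3 : S x = 0 := by
    rw [← norm_eq_zero, ← sq_eq_zero_iff]
    exact le_antisymm (h1.trans (mul_nonpos_of_nonneg_of_nonpos (norm_nonneg S) h2)) (sq_nonneg _)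
  rw [hS, sub_eq_zero] at h3
  exact h3.symm

theorem exists_eigenvectors_of_mem_diniSubdiffOn {A : Ksa H} {n kmax : ℕ}
    (hpos : 0 < lamK (A : H →L[ℝ] H) (n + 1))
    (hgap : n = 0 ∨ lamK (A : H →L[ℝ] H) (n + 1) < lamK (A : H →L[ℝ] H) n)
    (hmax : lamK (A : H →L[ℝ] H) (kmax + 1) < lamK (A : H →L[ℝ] H) (n + 1))
    {L : Submodule ℝ (Ksa H)} {s : Finset (Ksa H)}
    (hsL : Submodule.span ℝ (s : Set (Ksa H)) ≤ L) {η : Ksa H →L[ℝ] ℝ}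
    (hη : η ∈ diniSubdiffOn (fun S : Ksa H => lamK (S : H →L[ℝ] H) (n + 1)) L A) {ε : ℝ}
    (hε : 0 < ε) :
    ∃ ψ : Fin (kmax - n) → H,
      (∀ i, (A : H →L[ℝ] H) (ψ i) = lamK (A : H →L[ℝ] H) (n + 1) • ψ i) ∧
      (∀ i, ‖ψ i‖ ≤ 1) ∧ ∀ v ∈ s, |η v - ∑ i, ⟪(v : H →L[ℝ] H) (ψ i), ψ i⟫| < ε := by
  have hA := Ksa.isSymmetric A
  set l := lamK (A : H →L[ℝ] H) (n + 1) with hl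
  obtain ⟨X, c, hlc, hX, hXn, hXform⟩ := exists_gap_subspace hA A.2.2 hpos hgap
  obtain ⟨Y, hXY, hY, c', -, hc', hYform⟩ := (hX.mono hlc.le).exists_ge hA A.2.2 hpos
  have := hX.finite
  have := hY.finite
  have hYmax : Module.finrank ℝ Y ≤ kmax := by
    by_contra! hlt
    exact hmax.not_ge (le_lamK_of_form (by omega) hlt hY.le_form)
  have hF : Module.finrank ℝ (Xᗮ ⊓ Y : Submodule ℝ H) ≤ kmax - n := by
    have := Submodule.finrank_add_inf_finrank_orthogonal hXY
    omega
  obtain ⟨ψ, hψF, hψ1, hψ⟩ := exists_approx_form hF s η (fun v hv c hc => by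
    obtain ⟨C, hC⟩ := lamK_add_smul_le (v := (v : H →L[ℝ] H)) hA hXY hY.invariant
      (k := n + 1) (by omega) hpos hXform hc' hYform fun x hx hx' => hc x ⟨hx, hx'⟩
    exact le_of_mem_diniSubdiffOn hη (hsL hv) hC) hε
  exact ⟨ψ, fun i => apply_eq_smul_of_form_le hA
    (fun x hx => orthogonal_invariant hA hX.invariant hx) hXform (hψF i).1
    (hY.le_form _ (hψF i).2), hψ1, hψ⟩

/-- Without a gap above `λ_{n+1}`, positive rank-one directions do not increase it. -/
theorem apply_sq_nonpos_of_mem_diniSubdiffOn {A : Ksa H} {n : ℕ} (hn : 1 ≤ n)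
    (h0 : 0 ≤ lamK (A : H →L[ℝ] H) n)
    (hle : lamK (A : H →L[ℝ] H) n ≤ lamK (A : H →L[ℝ] H) (n + 1))
    {L : Submodule ℝ (Ksa H)} {η : Ksa H →L[ℝ] ℝ}
    (hη : η ∈ diniSubdiffOn (fun S : Ksa H => lamK (S : H →L[ℝ] H) (n + 1)) L A) {u : H}
    (hu : Ksa.sq u ∈ L) : η (Ksa.sq u) ≤ 0 := by
  refine le_of_mem_diniSubdiffOn hη hu (C := 0) (Eventually.of_forall fun τ => ?_)
  have := lamK_add_rankOne_le (A := (A : H →L[ℝ] H))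
    (B := ((A + τ • Ksa.sq u : Ksa H) : H →L[ℝ] H)) (u := u) hn h0 fun φ hφ => by
      simp [hφ]
  simp only [mul_zero, add_zero, zero_mul]
  exact this.trans hle

theorem exists_approx_eigenvectors_of_mem_approxSubdiff {T : Ksa H}
    (hT : ∀ φ : H, 0 ≤ ⟪(T : H →L[ℝ] H) φ, φ⟫) {n kmax : ℕ}
    (hlam : 0 < lamK (T : H →L[ℝ] H) (n + 1))
    (hmax : lamK (T : H →L[ℝ] H) (kmax + 1) < lamK (T : H →L[ℝ] H) (n + 1)) {ξ : Ksa H →L[ℝ] ℝ}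
    (hξ : ξ ∈ approxSubdiff (fun S : Ksa H => lamK (S : H →L[ℝ] H) (n + 1)) T)
    (s : Finset (Ksa H)) {ε : ℝ} (hε : 0 < ε) :
    ∃ φ : Fin (kmax - n) → H,
      (∀ i, ‖(T : H →L[ℝ] H) (φ i) - lamK (T : H →L[ℝ] H) (n + 1) • φ i‖ ≤ ε) ∧
      (∀ i, ‖φ i‖ ≤ 1) ∧ ∀ v ∈ s, |ξ v - ∑ i, ⟪(v : H →L[ℝ] H) (φ i), φ i⟫| < ε := by
  classical
  have hlip : ∀ A B : Ksa H, |lamK (A : H →L[ℝ] H) (n + 1) - lamK (B : H →L[ℝ] H) (n + 1)| ≤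
    ‖A - B‖ := fun A B => Ksa.abs_lamK_sub_le A B (by omega)
  have hξT := apply_self_eq_lamK (by omega) (approxSubdiff_subset_clarkeSubdiff hlip hξ)
  set l := lamK (T : H →L[ℝ] H) (n + 1) with hl
  obtain ⟨M, hM, hξM⟩ := exists_pos_bound (E := Ksa H) ξ
  obtain ⟨N, u, hu⟩ := exists_sum_sq_approx T hT (ε := l / 2 / M) (by positivity)
  set B := ∑ a, Ksa.sq (u a) with hB
  have hξB : l / 2 ≤ ξ B := by
    have h1 := (le_abs_self _).trans (hξM (T - B))
    rw [map_sub, hξT] at h1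
    have h2 : M * ‖T - B‖ ≤ M * (l / 2 / M) := by gcongr
    rw [mul_div_cancel₀ _ hM.ne'] at h2
    linarith
  set g := l - lamK (T : H →L[ℝ] H) (kmax + 1) with hg
  have hg0 : 0 < g := sub_pos.2 hmax
  set ρ := min (ε / 2) (min (l / 2) (g / 3)) with hρ
  have hρ0 : 0 < ρ := by positivity
  have hρ1 : ρ ≤ ε / 2 := min_le_left _ _
  have hρ2 : ρ ≤ l / 2 := (min_le_right _ _).trans (min_le_left _ _)
  have hρ3 : ρ ≤ g / 3 := (min_le_right _ _).trans (min_le_right _ _)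
  let t : Finset (Ksa H) := s ∪ Finset.univ.image fun a => Ksa.sq (u a)
  obtain ⟨A, hAT, -, η, hη, hηξ⟩ := hξ (Submodule.span ℝ (t : Set (Ksa H)))
    (FiniteDimensional.span_finset ℝ t) (insert B s) (min (ε / 2) (l / 2)) (by positivity) 1
    one_pos _ (Metric.ball_mem_nhds T hρ0)
  rw [Metric.mem_ball, dist_eq_norm] at hAT
  have h1 := abs_le.1 ((hlip A T).trans hAT.le)
  have h2 := abs_le.1 ((Ksa.abs_lamK_sub_le A T (k := kmax + 1) (by omega)).trans hAT.le)
  rw [← hl] at h1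
  have hApos : 0 < lamK (A : H →L[ℝ] H) (n + 1) := by linarith
  have hAmax : lamK (A : H →L[ℝ] H) (kmax + 1) < lamK (A : H →L[ℝ] H) (n + 1) := by linarith
  have hAgap : n = 0 ∨ lamK (A : H →L[ℝ] H) (n + 1) < lamK (A : H →L[ℝ] H) n := by
    by_contra! hcon
    obtain ⟨hn, hle⟩ := hcon
    have hn : 1 ≤ n := by omega
    have h3 : η B ≤ 0 := by
      rw [hB, map_sum]
      exact Finset.sum_nonpos fun a _ => apply_sq_nonpos_of_mem_diniSubdiffOn hn
        (hApos.le.trans (lamK_anti hn hApos)) hle hη (Submodule.subset_span (by simp [t]))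
    have h4 := (abs_lt.1 (hηξ B (by simp))).1
    linarith [min_le_right (ε / 2) (l / 2)]
  obtain ⟨ψ, hψA, hψ1, hψ⟩ := exists_eigenvectors_of_mem_diniSubdiffOn hApos hAgap hAmax
    (s := s) (Submodule.span_mono (by simp [t])) hη (half_pos hε)
  refine ⟨ψ, fun i => ?_, hψ1, fun v hv => ?_⟩
  · have e1 : (T : H →L[ℝ] H) (ψ i) - l • ψ i
        = (lamK (A : H →L[ℝ] H) (n + 1) - l) • ψ i - ((A - T : Ksa H) : H →L[ℝ] H) (ψ i) := by
      rw [Submodule.coe_sub, sub_apply, hψA, sub_smul]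
      abel
    have e2 : ‖((A - T : Ksa H) : H →L[ℝ] H) (ψ i)‖ ≤ ρ * 1 :=
      (ContinuousLinearMap.le_opNorm _ _).trans (by gcongr; exacts [hAT.le, hψ1 i])
    have e3 : ‖(lamK (A : H →L[ℝ] H) (n + 1) - l) • ψ i‖ ≤ ρ * 1 := by
      rw [norm_smul, Real.norm_eq_abs]
      gcongr
      exacts [abs_le.2 h1, hψ1 i]
    rw [e1]
    linarith [norm_sub_le ((lamK (A : H →L[ℝ] H) (n + 1) - l) • ψ i)
      (((A - T : Ksa H) : H →L[ℝ] H) (ψ i))]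
  · have h3 := abs_lt.1 (hηξ v (by simp [hv]))
    have h4 := abs_lt.1 (hψ v hv)
    have h5 := min_le_left (ε / 2) (l / 2)
    rw [abs_lt]
    constructor <;> linarith

theorem exists_eigenvectors_of_mem_approxSubdiff {T : Ksa H}
    (hT : ∀ φ : H, 0 ≤ ⟪(T : H →L[ℝ] H) φ, φ⟫) {n kmax : ℕ}
    (hlam : 0 < lamK (T : H →L[ℝ] H) (n + 1))
    (hmax : lamK (T : H →L[ℝ] H) (kmax + 1) < lamK (T : H →L[ℝ] H) (n + 1)) {ξ : Ksa H →L[ℝ] ℝ}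
    (hξ : ξ ∈ approxSubdiff (fun S : Ksa H => lamK (S : H →L[ℝ] H) (n + 1)) T) :
    ∃ φ : Fin (kmax - n) → H,
      (∀ i, (T : H →L[ℝ] H) (φ i) = lamK (T : H →L[ℝ] H) (n + 1) • φ i) ∧
      ∀ v : Ksa H, ξ v = ∑ i, ⟪(v : H →L[ℝ] H) (φ i), φ i⟫ := by
  choose Φ hΦT hΦ1 hΦ using fun p : Finset (Ksa H) × ℕ =>
    exists_approx_eigenvectors_of_mem_approxSubdiff hT hlam hmax hξ p.1
      (Nat.one_div_pos_of_nat (α := ℝ) (n := p.2))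
  set l := lamK (T : H →L[ℝ] H) (n + 1)
  let 𝒰 : Ultrafilter (Finset (Ksa H) × ℕ) := Ultrafilter.of (atTop ×ˢ atTop)
  have h𝒰 : (𝒰 : Filter (Finset (Ksa H) × ℕ)) ≤ atTop ×ˢ atTop := Ultrafilter.of_le _
  have hε : Tendsto (fun p : Finset (Ksa H) × ℕ => 1 / ((p.2 : ℝ) + 1)) 𝒰 (𝓝 0) :=
    (tendsto_one_div_add_atTop_nhds_zero_nat.comp tendsto_snd).mono_left h𝒰
  obtain ⟨K, hK, hKT⟩ := IsCompactOperator.image_closedBall_subset_compact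
    (f := ((T : H →L[ℝ] H) : H →ₗ[ℝ] H)) T.2.2 1
  have hlim : ∀ i, ∃ ψ, Tendsto (fun p => Φ p i) 𝒰 (𝓝 ψ) := fun i => by
    obtain ⟨y, -, hy⟩ := hK.ultrafilter_le_nhds' (𝒰.map fun p => (T : H →L[ℝ] H) (Φ p i))
      (Ultrafilter.mem_map.2 <| univ_mem' fun p =>
        hKT ⟨Φ p i, by simpa using hΦ1 p i, rfl⟩)
    have h1 : Tendsto (fun p => (T : H →L[ℝ] H) (Φ p i)) 𝒰 (𝓝 y) := hy
    have h2 : Tendsto (fun p => (T : H →L[ℝ] H) (Φ p i) - l • Φ p i) 𝒰 (𝓝 0) :=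
      squeeze_zero_norm (fun p => hΦT p i) hε
    refine ⟨l⁻¹ • (y - 0), ((h1.sub h2).const_smul l⁻¹).congr fun p => ?_⟩
    rw [sub_sub_cancel, inv_smul_smul₀ hlam.ne']
  choose ψ hψ using hlim
  refine ⟨ψ, fun i => ?_, fun v => ?_⟩
  · have h1 := (((T : H →L[ℝ] H).continuous.tendsto _).comp (hψ i)).sub ((hψ i).const_smul l)
    have h2 : Tendsto (fun p => (T : H →L[ℝ] H) (Φ p i) - l • Φ p i) 𝒰 (𝓝 0) :=
      squeeze_zero_norm (fun p => hΦT p i) hε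
    exact sub_eq_zero.1 (tendsto_nhds_unique h1 h2)
  · have h1 : Tendsto (fun p => ∑ i, ⟪(v : H →L[ℝ] H) (Φ p i), Φ p i⟫) 𝒰
        (𝓝 (∑ i, ⟪(v : H →L[ℝ] H) (ψ i), ψ i⟫)) := tendsto_finsetSum _ fun i _ =>
      (((v : H →L[ℝ] H).continuous.tendsto _).comp (hψ i)).inner (hψ i)
    have h2 : ∀ᶠ p : Finset (Ksa H) × ℕ in 𝒰, v ∈ p.1 :=
      (tendsto_fst.mono_left h𝒰).eventually <| (eventually_ge_atTop {v}).mono fun s hs =>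
        Finset.singleton_subset_iff.1 hs
    have h3 : Tendsto (fun p => ξ v - ∑ i, ⟪(v : H →L[ℝ] H) (Φ p i), Φ p i⟫) 𝒰 (𝓝 0) :=
      squeeze_zero_norm' (h2.mono fun p hp => (hΦ p v hp).le) hε
    exact sub_eq_zero.1 (tendsto_nhds_unique (h1.const_sub (ξ v)) h3)

/-- Eigenvectors for `λ_{n+1}` which are few enough leave room for an `n`-dimensional subspace
orthogonal to them that separates the spectrum at `λ_{n+1}`. -/
theorem exists_separating_subspace {A : H →L[ℝ] H} (hA : ∀ x y, ⟪A x, y⟫ = ⟪x, A y⟫)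
    (hc : IsCompactOperator A) {n kmax : ℕ} (hn : n < kmax) (hpos : 0 < lamK A (n + 1))
    (hmax : lamK A kmax = lamK A (n + 1)) {φ : Fin (kmax - n) → H}
    (hφ : ∀ i, A (φ i) = lamK A (n + 1) • φ i) :
    ∃ X : Submodule ℝ H, FiniteDimensional ℝ X ∧ Module.finrank ℝ X = n ∧
      (∀ x ∈ X, lamK A (n + 1) * ‖x‖ ^ 2 ≤ ⟪A x, x⟫) ∧
      (∀ x ∈ Xᗮ, ⟪A x, x⟫ ≤ lamK A (n + 1) * ‖x‖ ^ 2) ∧ ∀ i, φ i ∈ Xᗮ := by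
  classical
  set l := lamK A (n + 1) with hl
  have hex : ∃ j, lamK A (j + 1) = l := ⟨n, rfl⟩
  obtain ⟨j, hj, hjn, hjmin⟩ : ∃ j, lamK A (j + 1) = l ∧ j ≤ n ∧ ∀ i < j, lamK A (i + 1) ≠ l :=
    ⟨Nat.find hex, Nat.find_spec hex, Nat.find_min' hex rfl, fun i hi => Nat.find_min hex hi⟩
  have hjgap : j = 0 ∨ lamK A (j + 1) < lamK A j := by
    rcases j with _ | i
    · exact Or.inl rfl
    · refine Or.inr (lt_of_le_of_ne (lamK_anti (by omega) (hj ▸ hpos)) fun he => ?_)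
      exact hjmin i (by omega) (he ▸ hj)
  obtain ⟨P, c, hlc, hP, hPj, hPform⟩ := exists_gap_subspace hA hc (hj ▸ hpos) hjgap
  rw [hj] at hlc hPform
  obtain ⟨Y, hPY, hY, c', h0, hc', hYform⟩ := (hP.mono hlc.le).exists_ge hA hc hpos
  have := hP.finite
  have := hY.finite
  have hYmax : kmax ≤ Module.finrank ℝ Y := by
    by_contra! hlt
    exact (lamK_le_of_finrank_lt hlt h0 hYform).not_gt (hmax ▸ hc')
  have split : ∀ V : Submodule ℝ H, FiniteDimensional ℝ V → (∀ x ∈ V, A x ∈ V) → ∀ i,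
      ∃ p ∈ V, ∃ q ∈ Vᗮ, φ i = p + q ∧ ⟪A p, p⟫ = l * ‖p‖ ^ 2 ∧ ⟪A q, q⟫ = l * ‖q‖ ^ 2 := by
    intro V _ hV i
    obtain ⟨p, hp, q, hq, hpq⟩ := Submodule.mem_sup.1
      ((Submodule.sup_orthogonal_of_hasOrthogonalProjection (K := V)).symm ▸ Submodule.mem_top :
        φ i ∈ V ⊔ Vᗮ)
    have h1 := hφ i
    have e1 : ⟪p, q⟫ = 0 := Submodule.inner_right_of_mem_orthogonal hp hq
    have e2 : ⟪A p, q⟫ = 0 := Submodule.inner_right_of_mem_orthogonal (hV p hp) hq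
    have e3 : ⟪A q, p⟫ = 0 := by rw [hA, real_inner_comm, e2]
    rw [← hpq, map_add, smul_add] at h1
    have h2 := congrArg (fun z => ⟪z, p⟫) h1
    have h3 := congrArg (fun z => ⟪z, q⟫) h1
    simp only [inner_add_left, real_inner_smul_left, real_inner_self_eq_norm_sq, e1, e2, e3,
      real_inner_comm p q, mul_zero, add_zero, zero_add] at h2 h3
    exact ⟨p, hp, q, hq, hpq.symm, h2, h3⟩
  have hφY : ∀ i, φ i ∈ Y := fun i => by
    obtain ⟨p, hp, q, hq, hpq, -, h1⟩ := split Y hY.finite hY.invariant i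
    have h2 := hYform q hq
    have h3 : q = 0 := by
      by_contra h0
      have : 0 < ‖q‖ ^ 2 := by positivity
      nlinarith
    rw [hpq, h3, add_zero]
    exact hp
  have hφP : ∀ i, φ i ∈ Pᗮ := fun i => by
    obtain ⟨p, hp, q, hq, hpq, h1, -⟩ := split P hP.finite hP.invariant i
    have h2 := hP.le_form p hp
    have h3 : p = 0 := by
      by_contra h0
      have : 0 < ‖p‖ ^ 2 := by positivity
      nlinarith
    rw [hpq, h3, zero_add]
    exact hq
  set G := Submodule.span ℝ (Set.range φ) with hG
  have hGY : G ≤ Y := Submodule.span_le.2 (Set.range_subset_iff.2 hφY)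
  have hGP : G ≤ Pᗮ := Submodule.span_le.2 (Set.range_subset_iff.2 hφP)
  have hGcard : Module.finrank ℝ G ≤ kmax - n := by
    exact (finrank_range_le_card (R := ℝ) φ).trans_eq (Fintype.card_fin _)
  have hdim := Submodule.finrank_add_inf_finrank_orthogonal hGY
  have : FiniteDimensional ℝ (Gᗮ ⊓ Y : Submodule ℝ H) :=
    Submodule.finiteDimensional_of_le inf_le_right
  obtain ⟨X, hPX, hXG, hXn⟩ := exists_finrank_eq_between (V := P) (W := Gᗮ ⊓ Y) (n := n)
    (le_inf ((Submodule.le_orthogonal_orthogonal P).trans (Submodule.orthogonal_le hGP)) hPY)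
    (by omega) (by omega)
  refine ⟨X, Submodule.finiteDimensional_of_le hXG, hXn, fun x hx => hY.le_form x (hXG hx).2,
    fun x hx => hPform x (Submodule.orthogonal_le hPX hx), fun i => ?_⟩
  exact Submodule.orthogonal_le (hXG.trans inf_le_left)
    (Submodule.le_orthogonal_orthogonal G (Submodule.subset_span ⟨i, rfl⟩))

theorem mem_diniSubdiffOn_of_eigenvectors {A : Ksa H} {n : ℕ} {X : Submodule ℝ H}
    [FiniteDimensional ℝ X] (hXn : Module.finrank ℝ X = n) {ε : ℝ} (hε : 0 < ε)
    (hX : ∀ x ∈ X, (lamK (A : H →L[ℝ] H) (n + 1) + ε) * ‖x‖ ^ 2 ≤ ⟪(A : H →L[ℝ] H) x, x⟫)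
    {m : ℕ} {φ : Fin m → H} (hφX : ∀ i, φ i ∈ Xᗮ)
    (hφ : ∀ i, (A : H →L[ℝ] H) (φ i) = lamK (A : H →L[ℝ] H) (n + 1) • φ i)
    (hφ1 : ∑ i, ‖φ i‖ ^ 2 = 1) {ξ : Ksa H →L[ℝ] ℝ}
    (hξ : ∀ v : Ksa H, ξ v = ∑ i, ⟪(v : H →L[ℝ] H) (φ i), φ i⟫) (L : Submodule ℝ (Ksa H)) :
    ξ ∈ diniSubdiffOn (fun S : Ksa H => lamK (S : H →L[ℝ] H) (n + 1)) L A := by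
  set l := lamK (A : H →L[ℝ] H) (n + 1) with hl
  refine mem_diniSubdiffOn fun v => ⟨2 * (‖v‖ + 1) ^ 2 / ε, ?_⟩
  have e1 : ∀ᶠ p : Ksa H × ℝ in 𝓝 v ×ˢ 𝓝[>] (0 : ℝ), ‖p.1‖ < ‖v‖ + 1 :=
    tendsto_fst.eventually <| (continuous_norm.tendsto v).eventually_lt_const (lt_add_one _)
  have e2 : ∀ᶠ p : Ksa H × ℝ in 𝓝 v ×ˢ 𝓝[>] (0 : ℝ), p.2 ∈ Set.Ioo 0 (ε / 4 / (‖v‖ + 1)) :=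
    tendsto_snd.eventually (Ioo_mem_nhdsGT (by positivity))
  filter_upwards [e1, e2] with ⟨w, τ⟩ hw hτ
  simp only at hw hτ ⊢
  obtain ⟨hτ0, hτ1⟩ := hτ
  rw [lt_div_iff₀ (by positivity)] at hτ1
  have hτw : τ * ‖(w : H →L[ℝ] H)‖ ≤ ε / 4 := le_trans (by gcongr; exact hw.le) hτ1.le
  set r := lamK ((A + τ • w : Ksa H) : H →L[ℝ] H) (n + 1) with hr
  have key : ∀ i, τ * ⟪(w : H →L[ℝ] H) (φ i), φ i⟫
      ≤ ‖φ i‖ ^ 2 * (r - l + 2 * (‖v‖ + 1) ^ 2 / ε * τ ^ 2) := fun i => by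
    by_cases h0 : φ i = 0
    · simp [h0]
    have hn : 0 < ‖φ i‖ := norm_pos_iff.2 h0
    have h1 := le_lamK_add_smul (v := (w : H →L[ℝ] H)) (Ksa.isSymmetric A) hXn hε hX
      (φ := ‖φ i‖⁻¹ • φ i) (Xᗮ.smul_mem _ (hφX i)) (norm_smul_inv_norm h0)
      (by rw [map_smul, hφ, smul_comm]) hτ0.le hτw
    have h2 : 2 * ‖(w : H →L[ℝ] H)‖ ^ 2 / ε * τ ^ 2 ≤ 2 * (‖v‖ + 1) ^ 2 / ε * τ ^ 2 := by
      gcongr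
      exact hw.le
    rw [map_smul, real_inner_smul_left, real_inner_smul_right] at h1
    have h3 : lamK ((A : H →L[ℝ] H) + τ • (w : H →L[ℝ] H)) (n + 1) = r := rfl
    rw [h3] at h1
    have h4 : τ * ⟪(w : H →L[ℝ] H) (φ i), φ i⟫ = ‖φ i‖ ^ 2 *
        (τ * (‖φ i‖⁻¹ * (‖φ i‖⁻¹ * ⟪(w : H →L[ℝ] H) (φ i), φ i⟫))) := by field_simp
    rw [h4]
    gcongr
    linarith
  have hsum := Finset.sum_le_sum fun i (_ : i ∈ Finset.univ) => key i
  rw [← Finset.mul_sum, ← Finset.sum_mul, hφ1, ← hξ, one_mul] at hsum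
  linarith

theorem mem_approxSubdiff_of_eigenvectors {T : Ksa H} {n kmax : ℕ} (hn : n < kmax)
    (hlam : 0 < lamK (T : H →L[ℝ] H) (n + 1))
    (hmax : lamK (T : H →L[ℝ] H) kmax = lamK (T : H →L[ℝ] H) (n + 1)) {ξ : Ksa H →L[ℝ] ℝ}
    (hξT : ξ T = lamK (T : H →L[ℝ] H) (n + 1)) {φ : Fin (kmax - n) → H}
    (hφ : ∀ i, (T : H →L[ℝ] H) (φ i) = lamK (T : H →L[ℝ] H) (n + 1) • φ i)
    (hξ : ∀ v : Ksa H, ξ v = ∑ i, ⟪(v : H →L[ℝ] H) (φ i), φ i⟫) :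
    ξ ∈ approxSubdiff (fun S : Ksa H => lamK (S : H →L[ℝ] H) (n + 1)) T := by
  intro L _ s ε hε δ hδ U hU
  obtain ⟨X, hXfin, hXn, hXge, hXle, hφX⟩ :=
    exists_separating_subspace (Ksa.isSymmetric T) T.2.2 hn hlam hmax hφ
  set l := lamK (T : H →L[ℝ] H) (n + 1) with hl
  have hφ1 : ∑ i, ‖φ i‖ ^ 2 = 1 := by
    rw [hξ] at hξT
    simp only [hφ, real_inner_smul_left, real_inner_self_eq_norm_sq, ← Finset.mul_sum] at hξT
    exact (mul_eq_left₀ hlam.ne').1 hξT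
  have hcont : Tendsto (fun τ : ℝ => T + τ • Ksa.proj X) (𝓝[>] 0) (𝓝 T) := by
    have h1 : Continuous fun τ : ℝ => T + τ • Ksa.proj X := by fun_prop
    simpa using (h1.tendsto 0).mono_left nhdsWithin_le_nhds
  obtain ⟨τ, hτU, hτ⟩ := ((hcont.eventually hU).and self_mem_nhdsWithin).exists
  have hτ : 0 < τ := hτ
  set A := T + τ • Ksa.proj X with hAdef
  have hA : ∀ x, (A : H →L[ℝ] H) x = (T : H →L[ℝ] H) x + τ • (Ksa.proj X : H →L[ℝ] H) x :=
    fun x => rfl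
  have hAorth : ∀ x ∈ Xᗮ, (A : H →L[ℝ] H) x = (T : H →L[ℝ] H) x := fun x hx => by
    rw [hA, Ksa.proj_apply_of_mem_orthogonal hx, smul_zero, add_zero]
  have hAl : lamK (A : H →L[ℝ] H) (n + 1) = l := by
    refine le_antisymm (lamK_le_of_finrank_lt (X := X) (by omega) hlam.le fun x hx => ?_) ?_
    · rw [hAorth x hx]
      exact hXle x hx
    · have := lamK_le_affine (A := (A : H →L[ℝ] H)) (B := (T : H →L[ℝ] H)) (k := n + 1)
        (by omega) one_pos le_rfl fun x _ => by
          have h1 : 0 ≤ ⟪(Ksa.proj X : H →L[ℝ] H) x, x⟫ := by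
            rw [Ksa.proj_inner_self]
            positivity
          rw [hA, inner_add_left, real_inner_smul_left]
          nlinarith
      linarith
  refine ⟨A, hτU, by simpa [hAl, ← hl] using hδ, ξ,
    mem_diniSubdiffOn_of_eigenvectors hXn hτ (fun x hx => ?_) hφX (fun i => ?_) hφ1 hξ L,
    fun v _ => by simpa using hε⟩
  · rw [hAl, hA, Ksa.proj_apply_of_mem hx, inner_add_left, real_inner_smul_left,
      real_inner_self_eq_norm_sq]
    linarith [hXge x hx]
  · rw [hAl, hAorth _ (hφX i), hφ]

theorem approx_subdiff_eigenvalue (T₀ : Ksa H)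
    (hpos : ∀ φ : H, 0 ≤ ⟪(T₀ : H →L[ℝ] H) φ, φ⟫)
    (k : ℕ) (hk : 1 ≤ k) (hlam : 0 < lamK (T₀ : H →L[ℝ] H) k)
    (kmax : ℕ) (hkk : k ≤ kmax)
    (hmax1 : lamK (T₀ : H →L[ℝ] H) kmax = lamK (T₀ : H →L[ℝ] H) k)
    (hmax2 : lamK (T₀ : H →L[ℝ] H) (kmax + 1) < lamK (T₀ : H →L[ℝ] H) k) :
    approxSubdiff (fun S : Ksa H => lamK (S : H →L[ℝ] H) k) T₀ =
      {ξ : Ksa H →L[ℝ] ℝ |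
        ξ ∈ clarkeSubdiff (fun S : Ksa H => lamK (S : H →L[ℝ] H) k) T₀ ∧
        ∃ φ : Fin (kmax - k + 1) → H,
          (∀ i, φ i ∈ Module.End.eigenspace ((T₀ : H →L[ℝ] H) : H →ₗ[ℝ] H)
            (lamK (T₀ : H →L[ℝ] H) k)) ∧
          ∀ S : Ksa H, ξ S = ∑ i, ⟪(S : H →L[ℝ] H) (φ i), φ i⟫} := by
  obtain ⟨n, rfl⟩ : ∃ n, k = n + 1 := ⟨k - 1, by omega⟩
  have hm : kmax - (n + 1) + 1 = kmax - n := by omega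
  rw [hm]
  simp only [Module.End.mem_eigenspace_iff, ContinuousLinearMap.coe_coe]
  ext ξ
  constructor
  · intro hξ
    exact ⟨approxSubdiff_subset_clarkeSubdiff (fun A B => Ksa.abs_lamK_sub_le A B hk) hξ,
      exists_eigenvectors_of_mem_approxSubdiff hpos hlam hmax2 hξ⟩
  · rintro ⟨hξ, φ, hφ, hξφ⟩
    exact mem_approxSubdiff_of_eigenvectors (by omega) hlam hmax1 (apply_self_eq_lamK hk hξ) hφ hξφ
end

section
/- Let (X,μ), (Y,ν) be measure spaces, p, q ∈ [1,∞), and T : L^q(μ) → L^p(ν) a bounded linear operator. For any Hilbert space H, the algebraic tensor extension T ⊗ id_H, defined on simple tensors f·v ↦ (Tf)·v, extends to a bounded linear operator from L^q(μ, H) to L^p(ν, H) (Bochner spaces) with norm at most a constant times ‖T‖. -/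
open MeasureTheory
open scoped ENNReal

open ProbabilityTheory TensorProduct

theorem eLpNorm_rpow_toReal {Z ε : Type*} [MeasurableSpace Z] [ENorm ε] {p : ℝ≥0∞} (hp : p ≠ 0)
    (hp' : p ≠ ∞) (κ : Measure Z) (f : Z → ε) :
    eLpNorm f p κ ^ p.toReal = ∫⁻ x, ‖f x‖ₑ ^ p.toReal ∂κ := by
  rw [eLpNorm_eq_lintegral_rpow_enorm_toReal hp hp', ← ENNReal.rpow_mul,
    one_div_mul_cancel (ENNReal.toReal_pos hp hp').ne', ENNReal.rpow_one]

section Gaussian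

variable {E : Type*} [NormedAddCommGroup E] [InnerProductSpace ℝ E] [FiniteDimensional ℝ E]
  [MeasurableSpace E] [BorelSpace E]

theorem map_inner_stdGaussian (w : E) :
    (stdGaussian E).map (fun z => inner ℝ w z) = (gaussianReal 0 1).map (‖w‖ * ·) := by
  have h := IsGaussian.map_eq_gaussianReal (μ := stdGaussian E) (innerSL ℝ w)
  rw [integral_strongDual_stdGaussian, variance_dual_stdGaussian, innerSL_apply_norm] at h
  rw [gaussianReal_map_const_mul]
  convert! h using 2
  · simp
  · ext
    simp

theorem eLpNorm_inner_stdGaussian (w : E) (p : ℝ≥0∞) :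
    eLpNorm (fun z => inner ℝ w z) p (stdGaussian E) =
      ‖w‖ₑ * eLpNorm id p (gaussianReal 0 1) := by
  have h₁ : eLpNorm (fun z => inner ℝ w z) p (stdGaussian E) =
      eLpNorm id p ((stdGaussian E).map fun z => inner ℝ w z) := by
    rw [eLpNorm_map_measure (by fun_prop) (by fun_prop)]
    rfl
  rw [h₁, map_inner_stdGaussian, eLpNorm_map_measure (by fun_prop) (by fun_prop)]
  have h₂ := eLpNorm_const_smul ‖w‖ (id : ℝ → ℝ) p (gaussianReal 0 1)
  rw [enorm_norm] at h₂
  exact h₂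

/-- Minkowski's integral inequality for the Gaussian projections of a simple function. -/
theorem eLpNorm_eLpNorm_inner_simpleFunc_le {X : Type*} [MeasurableSpace X] (μ : Measure X)
    (p q : ℝ≥0∞) (hq : q ≠ 0) (hq' : q ≠ ∞) (F : SimpleFunc X E) :
    eLpNorm (fun z => eLpNorm (fun x => inner ℝ (F x) z) q μ) p (stdGaussian E) ≤
      eLpNorm id (max p q) (gaussianReal 0 1) * eLpNorm F q μ := by
  set r := max p q
  set a := q.toReal
  have ha : 0 < a := ENNReal.toReal_pos hq hq'
  have hsum (φ : E → ℝ) : eLpNorm (fun x => φ (F x)) q μ ^ a =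
      ∑ w ∈ F.range, ‖φ w‖ₑ ^ a * μ (F ⁻¹' {w}) := by
    rw [eLpNorm_rpow_toReal hq hq', ← SimpleFunc.map_lintegral (fun w => ‖φ w‖ₑ ^ a) F,
      ← SimpleFunc.lintegral_eq_lintegral]
    rfl
  have hmeas : Measurable fun z => eLpNorm (fun x => inner ℝ (F x) z) q μ := by
    have : (fun z => eLpNorm (fun x => inner ℝ (F x) z) q μ) =
        fun z => (∑ w ∈ F.range, ‖inner ℝ w z‖ₑ ^ a * μ (F ⁻¹' {w})) ^ a⁻¹ := by
      ext z
      rw [← hsum (fun w => inner ℝ w z), ENNReal.rpow_rpow_inv ha.ne']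
    rw [this]
    fun_prop
  refine (eLpNorm_le_eLpNorm_of_exponent_le (le_max_left p q)
    hmeas.aestronglyMeasurable).trans ?_
  have hr : r / q * ENNReal.ofReal a = r := by
    rw [ENNReal.ofReal_toReal hq', ENNReal.div_mul_cancel hq hq']
  have hr' : 1 ≤ r / q := by
    rw [ENNReal.le_div_iff_mul_le (.inl hq) (.inl hq'), one_mul]
    exact le_max_right p q
  rw [← ENNReal.rpow_le_rpow_iff ha, ENNReal.mul_rpow_of_nonneg _ _ ha.le]
  have hnorm : eLpNorm F q μ ^ a = ∑ w ∈ F.range, ‖w‖ₑ ^ a * μ (F ⁻¹' {w}) := by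
    simpa using hsum norm
  calc
    _ = eLpNorm (fun z => eLpNorm (fun x => inner ℝ (F x) z) q μ ^ a) (r / q)
          (stdGaussian E) := by
      have := eLpNorm_enorm_rpow (p := r / q) (μ := stdGaussian E)
        (fun z => eLpNorm (fun x => inner ℝ (F x) z) q μ) ha
      rw [hr] at this
      exact this.symm
    _ = eLpNorm (∑ w ∈ F.range, fun z => ‖inner ℝ w z‖ₑ ^ a * μ (F ⁻¹' {w})) (r / q)
          (stdGaussian E) := by
      congr 1
      ext z
      rw [Finset.sum_apply, hsum (fun w => inner ℝ w z)]
    _ ≤ ∑ w ∈ F.range, eLpNorm (fun z => ‖inner ℝ w z‖ₑ ^ a * μ (F ⁻¹' {w})) (r / q)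
          (stdGaussian E) :=
      eLpNorm_sum_le (fun w _ => Measurable.aestronglyMeasurable (by fun_prop)) hr'
    _ ≤ ∑ w ∈ F.range, μ (F ⁻¹' {w}) *
          eLpNorm (fun z => ‖inner ℝ w z‖ₑ ^ a) (r / q) (stdGaussian E) := by
      gcongr with w
      refine eLpNorm_le_mul_eLpNorm_of_ae_le_mul'' _ ?_ (.of_forall fun z => ?_)
      · exact Measurable.aestronglyMeasurable (by fun_prop)
      · simp [mul_comm]
    _ = eLpNorm id r (gaussianReal 0 1) ^ a * eLpNorm F q μ ^ a := by
      rw [hnorm, Finset.mul_sum]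
      refine Finset.sum_congr rfl fun w _ => ?_
      rw [eLpNorm_enorm_rpow _ ha, hr, eLpNorm_inner_stdGaussian,
        ENNReal.mul_rpow_of_nonneg _ _ ha.le]
      ring

theorem eLpNorm_eLpNorm_inner_of_sigmaFinite {Y : Type*} [MeasurableSpace Y] {ν : Measure Y}
    [SigmaFinite ν] {p : ℝ≥0∞} (hp : p ≠ 0) (hp' : p ≠ ∞) {G : Y → E}
    (hG : AEStronglyMeasurable G ν) :
    eLpNorm (fun z => eLpNorm (fun y => inner ℝ (G y) z) p ν) p (stdGaussian E) =
      eLpNorm id p (gaussianReal 0 1) * eLpNorm G p ν := by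
  have ha : 0 < p.toReal := ENNReal.toReal_pos hp hp'
  apply ENNReal.rpow_left_injective ha.ne'
  simp only [ENNReal.mul_rpow_of_nonneg _ _ ha.le, eLpNorm_rpow_toReal hp hp', enorm_eq_self]
  rw [lintegral_lintegral_swap]
  · simp only [← eLpNorm_rpow_toReal hp hp' (stdGaussian E), eLpNorm_inner_stdGaussian,
      ENNReal.mul_rpow_of_nonneg _ _ ha.le]
    rw [lintegral_mul_const'' _ (by fun_prop), eLpNorm_rpow_toReal hp hp' (gaussianReal 0 1),
      mul_comm]
  · have : AEStronglyMeasurable (fun x : E × Y => G x.2) ((stdGaussian E).prod ν) := hG.comp_snd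
    have h : AEStronglyMeasurable (fun x : E × Y => inner ℝ (G x.2) x.1)
        ((stdGaussian E).prod ν) := this.inner (by fun_prop)
    exact h.enorm.pow_const _

theorem eLpNorm_eLpNorm_inner_eq {Y : Type*} [MeasurableSpace Y] {ν : Measure Y}
    {p : ℝ≥0∞} (hp : p ≠ 0) (hp' : p ≠ ∞) {G : Y → E} (hG : MemLp G p ν) :
    eLpNorm (fun z => eLpNorm (fun y => inner ℝ (G y) z) p ν) p (stdGaussian E) =
      eLpNorm id p (gaussianReal 0 1) * eLpNorm G p ν := by
  have hfin : AEFinStronglyMeasurable G ν := hG.aefinStronglyMeasurable hp hp'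
  have hrestrict (φ : E → ℝ) (hφ : φ 0 = 0) :
      eLpNorm (fun y => φ (G y)) p ν =
        eLpNorm (fun y => φ (G y)) p (ν.restrict hfin.sigmaFiniteSet) := by
    rw [← eLpNorm_indicator_eq_eLpNorm_restrict hfin.measurableSet]
    refine eLpNorm_congr_ae ?_
    have h := hfin.ae_eq_zero_compl
    rw [Filter.EventuallyEq, ae_restrict_iff' hfin.measurableSet.compl] at h
    filter_upwards [h] with y hy
    by_cases hyt : y ∈ hfin.sigmaFiniteSet
    · simp [hyt]
    · simp [hyt, hy hyt, hφ]
  rw [← eLpNorm_norm G, hrestrict norm norm_zero, eLpNorm_norm]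
  simp only [fun z => hrestrict (fun w => inner ℝ w z) (inner_zero_left z)]
  exact eLpNorm_eLpNorm_inner_of_sigmaFinite hp hp' hG.1.restrict

end Gaussian

theorem eLpNorm_id_gaussianReal_ne_zero {p : ℝ≥0∞} (hp : p ≠ 0) :
    eLpNorm id p (gaussianReal 0 1) ≠ 0 := by
  intro h
  rw [eLpNorm_eq_zero_iff (by fun_prop) hp] at h
  have := variance_congr h
  rw [variance_id_gaussianReal] at this
  simp at this

section Tensor

variable {X Y : Type*} [MeasurableSpace X] [MeasurableSpace Y] {μ : Measure X} {ν : Measure Y}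
  {p q : ℝ≥0∞} [Fact (1 ≤ p)] [Fact (1 ≤ q)]
  {E F : Type*} [NormedAddCommGroup E] [NormedSpace ℝ E] [NormedAddCommGroup F] [NormedSpace ℝ F]

theorem compLpL_compLpL {D : Type*} [NormedAddCommGroup D] [NormedSpace ℝ D]
    (L : E →L[ℝ] F) (K : D →L[ℝ] E) (f : Lp D q μ) :
    L.compLpL q μ (K.compLpL q μ f) = (L.comp K).compLpL q μ f := by
  ext1
  filter_upwards [L.coeFn_compLpL (K.compLpL q μ f), K.coeFn_compLpL f,
    (L.comp K).coeFn_compLpL f] with x h₁ h₂ h₃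
  rw [h₁, h₂, h₃, ContinuousLinearMap.comp_apply]

theorem norm_compLpL_linearIsometry (L : E →ₗᵢ[ℝ] F) (f : Lp E q μ) :
    ‖L.toContinuousLinearMap.compLpL q μ f‖ = ‖f‖ := by
  rw [Lp.norm_def, Lp.norm_def]
  congr 1
  refine eLpNorm_congr_norm_ae ?_
  filter_upwards [L.toContinuousLinearMap.coeFn_compLpL f] with x hx
  rw [hx, LinearIsometry.coe_toContinuousLinearMap, L.norm_map]

variable (μ q E) in
/-- The canonical map `L^q(μ) ⊗ E → L^q(μ, E)`. -/
noncomputable def tensorToLp : Lp ℝ q μ ⊗[ℝ] E →ₗ[ℝ] Lp E q μ :=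
  TensorProduct.lift (LinearMap.flip
    ((ContinuousLinearMap.toSpanSingletonCLE (𝕜 := ℝ) (E := E)).toContinuousLinearMap.compLpₗ₂ q μ))

theorem tensorToLp_tmul (f : Lp ℝ q μ) (v : E) :
    tensorToLp μ q E (f ⊗ₜ v) = (ContinuousLinearMap.toSpanSingleton ℝ v).compLpL q μ f :=
  rfl

theorem coeFn_tensorToLp_tmul (f : Lp ℝ q μ) (v : E) :
    tensorToLp μ q E (f ⊗ₜ v) =ᵐ[μ] fun x => f x • v :=
  (ContinuousLinearMap.toSpanSingleton ℝ v).coeFn_compLpL f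

theorem compLpL_tensorToLp (L : E →L[ℝ] F) (t : Lp ℝ q μ ⊗[ℝ] E) :
    L.compLpL q μ (tensorToLp μ q E t) = tensorToLp μ q F (L.toLinearMap.lTensor _ t) := by
  induction t with
  | zero => simp
  | add s t hs ht => simp only [map_add, hs, ht]
  | tmul f v =>
    rw [LinearMap.lTensor_tmul, tensorToLp_tmul, tensorToLp_tmul, compLpL_compLpL]
    congr 2
    ext
    simp

theorem compLpL_dual_tensorToLp_tmul (φ : E →L[ℝ] ℝ) (f : Lp ℝ q μ) (v : E) :
    φ.compLpL q μ (tensorToLp μ q E (f ⊗ₜ v)) = φ v • f := by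
  ext1
  filter_upwards [φ.coeFn_compLpL (tensorToLp μ q E (f ⊗ₜ v)), coeFn_tensorToLp_tmul f v,
    Lp.coeFn_smul (φ v) f] with x h₁ h₂ h₃
  rw [h₁, h₂, h₃, map_smul, Pi.smul_apply, smul_eq_mul, smul_eq_mul, mul_comm]

theorem denseRange_tensorToLp (hq : q ≠ ∞) : DenseRange (tensorToLp μ q E) := by
  intro g
  induction g using Lp.induction hq with
  | @indicatorConst c s hs hμs =>
    refine subset_closure ⟨indicatorConstLp q hs hμs.ne 1 ⊗ₜ c, ?_⟩
    ext1
    rw [Lp.simpleFunc.coe_indicatorConst]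
    filter_upwards [coeFn_tensorToLp_tmul (indicatorConstLp q hs hμs.ne (1 : ℝ)) c,
      indicatorConstLp_coeFn (p := q) (hs := hs) (hμs := hμs.ne) (c := c),
      indicatorConstLp_coeFn (p := q) (hs := hs) (hμs := hμs.ne) (c := (1 : ℝ))] with x h₁ h₂ h₃
    rw [h₁, h₂, h₃]
    by_cases hx : x ∈ s <;> simp [Set.indicator, hx]
  | add f g _ hf hg => exact (LinearMap.range (tensorToLp μ q E)).topologicalClosure.add_mem hf hg
  | isClosed => exact isClosed_closure

end Tensor

section FiniteDimensional

variable {X Y : Type*} [MeasurableSpace X] [MeasurableSpace Y] {μ : Measure X} {ν : Measure Y}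
  {p q : ℝ≥0∞} [Fact (1 ≤ p)] [Fact (1 ≤ q)]
  {E : Type*} [NormedAddCommGroup E] [InnerProductSpace ℝ E] [FiniteDimensional ℝ E]

/-- The extension of `T : L^q(μ) → L^p(ν)` to functions with values in a Euclidean space, acting
coordinatewise. -/
noncomputable def coordExtension (E : Type*) [NormedAddCommGroup E] [InnerProductSpace ℝ E]
    [FiniteDimensional ℝ E] (T : Lp ℝ q μ →L[ℝ] Lp ℝ p ν) : Lp E q μ →L[ℝ] Lp E p ν :=
  ∑ i, (ContinuousLinearMap.toSpanSingleton ℝ (stdOrthonormalBasis ℝ E i)).compLpL p ν ∘L T ∘L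
    (innerSL ℝ (stdOrthonormalBasis ℝ E i)).compLpL q μ

theorem coordExtension_tensorToLp (T : Lp ℝ q μ →L[ℝ] Lp ℝ p ν) (t : Lp ℝ q μ ⊗[ℝ] E) :
    coordExtension E T (tensorToLp μ q E t) =
      tensorToLp ν p E (T.toLinearMap.rTensor E t) := by
  induction t with
  | zero => simp
  | add s t hs ht => simp only [map_add, hs, ht]
  | tmul f v =>
    simp only [coordExtension, _root_.sum_apply, ContinuousLinearMap.comp_apply,
      compLpL_dual_tensorToLp_tmul, innerSL_apply_apply, map_smul, ← tensorToLp_tmul,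
      LinearMap.rTensor_tmul]
    simp only [← map_smul, ← TensorProduct.tmul_smul, ← map_sum, ← TensorProduct.tmul_sum,
      (stdOrthonormalBasis ℝ E).sum_repr']
    rfl

theorem compLpL_coordExtension (hq : q ≠ ∞) (T : Lp ℝ q μ →L[ℝ] Lp ℝ p ν) (φ : E →L[ℝ] ℝ)
    (g : Lp E q μ) :
    φ.compLpL p ν (coordExtension E T g) = T (φ.compLpL q μ g) := by
  refine (denseRange_tensorToLp hq).induction_on g (isClosed_eq (by fun_prop) (by fun_prop))
    fun t => ?_
  rw [coordExtension_tensorToLp]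
  induction t with
  | zero => simp
  | add s t hs ht => simp only [map_add, hs, ht]
  | tmul f v =>
    rw [LinearMap.rTensor_tmul, compLpL_dual_tensorToLp_tmul, compLpL_dual_tensorToLp_tmul,
      map_smul]
    rfl

variable (p q) in
/-- The ratio of the Gaussian moments of orders `max p q` and `p`. -/
noncomputable def gaussianMomentRatio : ℝ≥0∞ :=
  eLpNorm id (max p q) (gaussianReal 0 1) / eLpNorm id p (gaussianReal 0 1)

theorem enorm_coordExtension_simpleFunc_le (hp : p ≠ ∞) (hq : q ≠ ∞)
    (T : Lp ℝ q μ →L[ℝ] Lp ℝ p ν) (g : Lp.simpleFunc E q μ) :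
    ‖coordExtension E T g‖ₑ ≤ gaussianMomentRatio p q * (‖T‖ₑ * ‖(g : Lp E q μ)‖ₑ) := by
  borelize E
  have hp0 : p ≠ 0 := (zero_lt_one.trans_le Fact.out).ne'
  have hq0 : q ≠ 0 := (zero_lt_one.trans_le Fact.out).ne'
  set F := Lp.simpleFunc.toSimpleFunc g
  have hF : F =ᵐ[μ] g := Lp.simpleFunc.toSimpleFunc_eq_toFun g
  have hT (z : E) : eLpNorm (fun y => inner ℝ (coordExtension E T g y) z) p ν ≤
      ‖T‖ₑ * eLpNorm (fun x => inner ℝ (F x) z) q μ := by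
    calc
      _ = ‖(innerSL ℝ z).compLpL p ν (coordExtension E T g)‖ₑ := by
        rw [Lp.enorm_def]
        refine eLpNorm_congr_ae ?_
        filter_upwards [(innerSL ℝ z).coeFn_compLpL (coordExtension E T g)] with y hy
        rw [hy, innerSL_apply_apply, real_inner_comm]
      _ = ‖T ((innerSL ℝ z).compLpL q μ g)‖ₑ := by rw [compLpL_coordExtension hq]
      _ ≤ ‖T‖ₑ * ‖(innerSL ℝ z).compLpL q μ (g : Lp E q μ)‖ₑ := T.le_opENorm _
      _ = _ := by
        rw [Lp.enorm_def]
        congr 1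
        refine eLpNorm_congr_ae ?_
        filter_upwards [(innerSL ℝ z).coeFn_compLpL (g : Lp E q μ), hF] with x hx hFx
        rw [hx, innerSL_apply_apply, real_inner_comm, hFx]
  have key : eLpNorm id p (gaussianReal 0 1) * ‖coordExtension E T g‖ₑ ≤
      ‖T‖ₑ * (eLpNorm id (max p q) (gaussianReal 0 1) * ‖(g : Lp E q μ)‖ₑ) := by
    rw [Lp.enorm_def, Lp.enorm_def, ← eLpNorm_congr_ae hF, ← eLpNorm_eLpNorm_inner_eq hp0 hp
      (Lp.memLp _)]
    refine (eLpNorm_le_mul_eLpNorm_of_ae_le_mul' (c := ‖T‖₊)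
      (g := fun z => eLpNorm (fun x => inner ℝ (F x) z) q μ) (.of_forall hT) p).trans ?_
    change ‖T‖ₑ * _ ≤ _
    gcongr
    exact eLpNorm_eLpNorm_inner_simpleFunc_le μ p q hq0 hq F
  rw [gaussianMomentRatio, ← ENNReal.mul_div_right_comm, ENNReal.le_div_iff_mul_le
    (.inl (eLpNorm_id_gaussianReal_ne_zero hp0)) (.inl (memLp_id_gaussianReal' p hp).2.ne),
    mul_comm]
  exact key.trans_eq (by ring)

omit [Fact (1 ≤ q)] in
theorem gaussianMomentRatio_ne_top (hp : p ≠ ∞) (hq : q ≠ ∞) : gaussianMomentRatio p q ≠ ∞ :=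
  ENNReal.div_ne_top (memLp_id_gaussianReal' _ (max_lt hp.lt_top hq.lt_top).ne).2.ne
    (eLpNorm_id_gaussianReal_ne_zero (zero_lt_one.trans_le Fact.out).ne')

theorem norm_coordExtension_apply_le (hp : p ≠ ∞) (hq : q ≠ ∞)
    (T : Lp ℝ q μ →L[ℝ] Lp ℝ p ν) (g : Lp E q μ) :
    ‖coordExtension E T g‖ ≤ (gaussianMomentRatio p q).toReal * ‖T‖ * ‖g‖ := by
  refine (Lp.simpleFunc.denseRange hq).induction_on g
    (isClosed_le (by fun_prop) (by fun_prop)) fun g => ?_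
  have h := ENNReal.toReal_mono (ENNReal.mul_ne_top (gaussianMomentRatio_ne_top hp hq)
    (ENNReal.mul_ne_top enorm_ne_top enorm_ne_top)) (enorm_coordExtension_simpleFunc_le hp hq T g)
  simpa [mul_assoc] using h

end FiniteDimensional

theorem norm_tensorToLp_rTensor_le {X Y : Type*} [MeasurableSpace X] [MeasurableSpace Y]
    {μ : Measure X} {ν : Measure Y} {p q : ℝ≥0∞} [Fact (1 ≤ p)] [Fact (1 ≤ q)]
    {H : Type*} [NormedAddCommGroup H] [InnerProductSpace ℝ H] (hp : p ≠ ∞) (hq : q ≠ ∞)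
    (T : Lp ℝ q μ →L[ℝ] Lp ℝ p ν) (t : Lp ℝ q μ ⊗[ℝ] H) :
    ‖tensorToLp ν p H (T.toLinearMap.rTensor H t)‖ ≤
      (gaussianMomentRatio p q).toReal * ‖T‖ * ‖tensorToLp μ q H t‖ := by
  obtain ⟨V, _, hV⟩ :=
    TensorProduct.exists_finite_submodule_right_of_setFinite {t} (Set.finite_singleton t)
  obtain ⟨s, rfl⟩ := hV rfl
  have hcomm := DFunLike.congr_fun
    ((LinearMap.rTensor_comp_lTensor _ T.toLinearMap V.subtype).trans
      (LinearMap.lTensor_comp_rTensor _ T.toLinearMap V.subtype).symm) s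
  simp only [LinearMap.comp_apply] at hcomm
  have h₁ := norm_compLpL_linearIsometry V.subtypeₗᵢ (tensorToLp μ q V s)
  have h₂ := norm_compLpL_linearIsometry V.subtypeₗᵢ (coordExtension V T (tensorToLp μ q V s))
  rw [compLpL_tensorToLp] at h₁
  rw [coordExtension_tensorToLp, compLpL_tensorToLp, ← coordExtension_tensorToLp] at h₂
  rw [hcomm]
  exact (h₂.le.trans (norm_coordExtension_apply_le hp hq T _)).trans_eq (congrArg _ h₁.symm)

theorem scalar_to_vector_extension
    {X Y : Type*} [MeasurableSpace X] [MeasurableSpace Y]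
    (μ : Measure X) (ν : Measure Y) (p q : ℝ≥0∞) [Fact (1 ≤ p)] [Fact (1 ≤ q)]
    (hp : p ≠ ⊤) (hq : q ≠ ⊤)
    (T : Lp ℝ q μ →L[ℝ] Lp ℝ p ν)
    (H : Type*) [NormedAddCommGroup H] [InnerProductSpace ℝ H] [CompleteSpace H] :
    ∃ (C : ℝ) (T' : Lp H q μ →L[ℝ] Lp H p ν), 0 ≤ C ∧ ‖T'‖ ≤ C * ‖T‖ ∧
      ∀ (f : Lp ℝ q μ) (g : Lp H q μ) (v : H),
        (⇑g =ᵐ[μ] fun x => f x • v) → ⇑(T' g) =ᵐ[ν] fun y => T f y • v := by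
  have hdense : DenseRange (tensorToLp μ q H) := denseRange_tensorToLp hq
  have hbound := norm_tensorToLp_rTensor_le (H := H) hp hq T
  refine ⟨(gaussianMomentRatio p q).toReal,
    (tensorToLp ν p H ∘ₗ T.toLinearMap.rTensor H).extendOfNorm (tensorToLp μ q H),
    ENNReal.toReal_nonneg, LinearMap.opNorm_extendOfNorm_le hdense (by positivity) hbound,
    fun f g v hg => ?_⟩
  obtain rfl : g = tensorToLp μ q H (f ⊗ₜ v) :=
    Lp.ext (hg.trans (coeFn_tensorToLp_tmul f v).symm)
  rw [LinearMap.extendOfNorm_eq hdense ⟨_, hbound⟩]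
  exact coeFn_tensorToLp_tmul (T f) v
end
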